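/- Fix d ≥ 1 and for each n let V_n := { x ∈ ℤ^d : x_1² + ⋯ + x_d² ≤ n }, let K_n be the restriction to V_n × V_n of the simple random walk matrix of ℤ^d (walk killed upon exiting V_n), ν_n the uniform law on V_n, and λ_n ∈ (0,∞). Set g_d(n) := 1 if d = 1, n log n if d = 2, and n^{d−1} if d ≥ 3. Then the ARW(K_n,λ_n,ν_n) chain satisfies t_rel^{(n)} = O(g_d(n)) and t_sep^{(n)} = |V_n| + o(|V_n|), and the sequence exhibits separation cutoff with window O(√(n^d g_d(n))). -/

import Mathlib

open scoped ENNReal BigOperators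
open Filter Asymptotics

namespace ARW

variable {V : Type} [Fintype V] [DecidableEq V]

/-- A sub-stochastic matrix: every row sums to at most `1`. -/
def SubStochastic (K : V → V → ℝ≥0∞) : Prop := ∀ x, ∑ y, K x y ≤ 1

/-- Non-degenerate: no principal sub-matrix of `K` is stochastic. -/
def NonDegenerate (K : V → V → ℝ≥0∞) : Prop :=
  ∀ S : Finset V, S.Nonempty → ∃ x ∈ S, ∑ y ∈ S, K x y ≠ 1

/-- A probability vector on `V`. -/
def IsProbVec (ν : V → ℝ≥0∞) : Prop := ∑ x, ν x = 1

/-- Probability that the `K`-walk currently at `x` next follows the trajectory `xs`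
and is then killed. -/
noncomputable def pathProb (K : V → V → ℝ≥0∞) : V → List V → ℝ≥0∞
  | x, [] => 1 - ∑ y, K x y
  | x, y :: ys => K x y * pathProb K y ys

/-- Probability that a `(K,ν)`-walk has the (finite) full trajectory `w`. -/
noncomputable def walkProb (K : V → V → ℝ≥0∞) (ν : V → ℝ≥0∞) : List V → ℝ≥0∞
  | [] => 0
  | x :: xs => ν x * pathProb K x xs

/-- `p(x)`: the probability that a `(K,ν)`-walk visits `x` before dying. -/
noncomputable def hitProb (K : V → V → ℝ≥0∞) (ν : V → ℝ≥0∞) (x : V) : ℝ≥0∞ :=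
  ∑' w : List V, if x ∈ w then walkProb K ν w else 0

/-- The insertion law `ν` is admissible when every site has a chance of being
visited by a `(K,ν)`-walk. -/
def Admissible (K : V → V → ℝ≥0∞) (ν : V → ℝ≥0∞) : Prop := ∀ x, 0 < hitProb K ν x

/-- The uniform law on `V`. -/
noncomputable def unifLaw (V : Type) [Fintype V] : V → ℝ≥0∞ :=
  fun _ => (Fintype.card V : ℝ≥0∞)⁻¹

/-! ### IDLA -/

/-- The IDLA update: the walker settles at the first site of its trajectory
which is not already occupied. -/
def idlaUpdate (S : Finset V) : List V → Finset V
  | [] => S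
  | x :: xs => if x ∈ S then idlaUpdate S xs else insert x S

/-- The IDLA aggregate obtained from the initial set `A` after using the walks `ws`. -/
def idlaSet (A : Finset V) (ws : List (List V)) : Finset V := ws.foldl idlaUpdate A

/-- `P(T^A > t)`: probability that the IDLA process started from `A` and driven by
i.i.d. `(K,ν)`-walks has not filled `V` after `t` steps. -/
noncomputable def idlaTail (K : V → V → ℝ≥0∞) (ν : V → ℝ≥0∞) (A : Finset V) (t : ℕ) : ℝ≥0∞ :=
  ∑' ws : Fin t → List V,
    (∏ i, walkProb K ν (ws i)) * (if idlaSet A (List.ofFn ws) = Finset.univ then 0 else 1)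

/-- `E[T^A]`: the expected filling time of IDLA started from `A`. -/
noncomputable def idlaMean (K : V → V → ℝ≥0∞) (ν : V → ℝ≥0∞) (A : Finset V) : ℝ≥0∞ :=
  ∑' t : ℕ, idlaTail K ν A t

/-- `Var(T^A)`: the variance of the filling time of IDLA started from `A`. -/
noncomputable def idlaVar (K : V → V → ℝ≥0∞) (ν : V → ℝ≥0∞) (A : Finset V) : ℝ≥0∞ :=
  (∑' t : ℕ, (2 * t + 1) * idlaTail K ν A t) - (idlaMean K ν A) ^ 2

/-! ### The ARW chain -/

/-- The state of a single site: empty, one sleeping particle, or `n+1` active particles. -/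
inductive Site : Type
  | empty : Site
  | sleeping : Site
  | active (n : ℕ) : Site
deriving DecidableEq

/-- A configuration of particles. -/
abbrev Conf (V : Type) := V → Site

def Site.isActive : Site → Bool
  | .active _ => true
  | _ => false

/-- The set of sites holding at least one active particle. -/
def activeSites (η : Conf V) : Finset V := Finset.univ.filter fun x => (η x).isActive

/-- Adding one active particle to a site (waking a sleeping particle if present). -/
def Site.addActive : Site → Site
  | .empty => .active 0
  | .sleeping => .active 1
  | .active n => .active (n + 1)

/-- Removing one active particle from a site. -/
def Site.removeOne : Site → Site
  | .active (n + 1) => .active n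
  | _ => .empty

/-- Adding one active particle at site `y`. -/
def addActiveAt (η : Conf V) (y : V) : Conf V := Function.update η y (η y).addActive

/-- One sequential toppling step of ARW stabilization with sleep rate `lam`:
an active site `x` is selected (if any); if its particle is alone it falls asleep
with probability `lam/(1+lam)`, moves to `y` with probability `K x y/(1+lam)` and
dies with the remaining probability; if it is not alone it moves to `y` with
probability `K x y` and dies with the remaining probability.  Stable
configurations are absorbing. -/
noncomputable def toppleKernel (K : V → V → ℝ≥0∞) (lam : ℝ) (η ξ : Conf V) : ℝ≥0∞ :=
  if h : (activeSites η).Nonempty then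
    let x := h.choose
    let ημ : Conf V := Function.update η x (η x).removeOne
    let move : ℝ≥0∞ := ∑ y, if ξ = addActiveAt ημ y then K x y else 0
    let die : ℝ≥0∞ := if ξ = ημ then 1 - ∑ y, K x y else 0
    if η x = Site.active 0 then
      ((if ξ = Function.update η x Site.sleeping then ENNReal.ofReal lam else 0) + move + die)
        / (ENNReal.ofReal lam + 1)
    else move + die
  else if ξ = η then 1 else 0

/-- Iterates of a sub-probability kernel on configurations. -/
noncomputable def kernelPow (M : Conf V → Conf V → ℝ≥0∞) : ℕ → Conf V → Conf V → ℝ≥0∞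
  | 0 => fun η ξ => if ξ = η then 1 else 0
  | t + 1 => fun η ξ => ∑' σ : Conf V, M η σ * kernelPow M t σ ξ

/-- A stable configuration, seen as a configuration (`true` = sleeping particle). -/
def embed (b : V → Bool) : Conf V := fun x => if b x then Site.sleeping else Site.empty

/-- One step of the `ARW(K,lam,ν)` chain: insert an active particle at a `ν`-distributed
site and stabilize; `arwStep K lam ν η ξ` is the probability of reaching the stable
configuration `ξ` from the stable configuration `η`. -/
noncomputable def arwStep (K : V → V → ℝ≥0∞) (lam : ℝ) (ν : V → ℝ≥0∞)
    (η ξ : V → Bool) : ℝ≥0∞ :=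
  ∑ x, ν x * ⨆ t, kernelPow (toppleKernel K lam) t (addActiveAt (embed η) x) (embed ξ)

/-- The transition matrix of the `ARW(K,lam,ν)` chain on stable configurations. -/
noncomputable def arwMatrix (K : V → V → ℝ≥0∞) (lam : ℝ) (ν : V → ℝ≥0∞) :
    Matrix (V → Bool) (V → Bool) ℝ :=
  Matrix.of fun η ξ => (arwStep K lam ν η ξ).toReal

/-! ### Distances to equilibrium, mixing and relaxation times -/

variable {S : Type} [Fintype S] [DecidableEq S]

/-- `π` is a stationary probability distribution for `P`. -/
def IsStationary (P : Matrix S S ℝ) (π : S → ℝ) : Prop :=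
  (∀ s, 0 ≤ π s) ∧ (∑ s, π s = 1) ∧ ∀ s, ∑ r, π r * P r s = π s

/-- The separation distance to equilibrium at time `t`. -/
noncomputable def sepDist (P : Matrix S S ℝ) (π : S → ℝ) (t : ℕ) : ℝ :=
  ⨆ η, ⨆ ξ, (1 - (P ^ t) η ξ / π ξ)

/-- The separation mixing time with precision `ε`. -/
noncomputable def sepMix (P : Matrix S S ℝ) (π : S → ℝ) (ε : ℝ) : ℕ :=
  sInf {t : ℕ | sepDist P π t ≤ ε}

/-- The total-variation distance to equilibrium at time `t`. -/
noncomputable def tvDist (P : Matrix S S ℝ) (π : S → ℝ) (t : ℕ) : ℝ :=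
  ⨆ η, ⨆ A : Finset S, |∑ ξ ∈ A, ((P ^ t) η ξ - π ξ)|

/-- The total-variation mixing time with precision `ε`. -/
noncomputable def tvMix (P : Matrix S S ℝ) (π : S → ℝ) (ε : ℝ) : ℕ :=
  sInf {t : ℕ | tvDist P π t ≤ ε}

/-- The relaxation time `1/(1-ρ)`, where `ρ` is the largest modulus of the
(complex) eigenvalues of `P` other than `1`. -/
noncomputable def relTime (P : Matrix S S ℝ) : ℝ :=
  (1 - sSup {r : ℝ | ∃ z : ℂ,
      z ≠ 1 ∧ (P.map (fun a : ℝ => (a : ℂ))).charpoly.IsRoot z ∧ r = ‖z‖})⁻¹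

/-- Separation (or total-variation) cutoff for a sequence of chains with distance
functions `d n` and mixing times `ts n`. -/
def HasCutoff (d : ℕ → ℕ → ℝ) (ts : ℕ → ℕ) : Prop :=
  ∀ α : ℝ, 0 ≤ α →
    (α < 1 → Tendsto (fun n => d n ⌊α * (ts n : ℝ)⌋₊) atTop (nhds 1)) ∧
    (1 < α → Tendsto (fun n => d n ⌊α * (ts n : ℝ)⌋₊) atTop (nhds 0))

end ARW
namespace ARW

/-- The discrete Euclidean ball `{x ∈ ℤ^d : x₁² + ⋯ + x_d² ≤ n}`. -/
def LatticeBall (d n : ℕ) : Type := {x : Fin d → ℤ // ∑ i, (x i) ^ 2 ≤ (n : ℤ)}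

instance (d n : ℕ) : Finite (LatticeBall d n) := by
  have hmem : ∀ x : LatticeBall d n, ∀ i,
      x.1 i ∈ Finset.Icc (-(n : ℤ) - 1) ((n : ℤ) + 1) := by
    rintro ⟨x, hx⟩ i
    have h1 : (x i) ^ 2 ≤ (n : ℤ) :=
      le_trans (Finset.single_le_sum (fun j _ => sq_nonneg (x j)) (Finset.mem_univ i)) hx
    have h0 : (0 : ℤ) ≤ |x i| := abs_nonneg _
    have h2 : |x i| ≤ (n : ℤ) + 1 := by nlinarith [sq_abs (x i), sq_nonneg (|x i| - 1)]
    rw [Finset.mem_Icc]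
    exact ⟨by linarith [neg_abs_le (x i)], by linarith [le_abs_self (x i)]⟩
  exact Finite.of_injective
    (fun x : LatticeBall d n =>
      (fun i => (⟨x.1 i, hmem x i⟩ : ↥(Finset.Icc (-(n : ℤ) - 1) ((n : ℤ) + 1)))))
    (by
      intro a b h
      apply Subtype.ext
      funext i
      exact congrArg Subtype.val (congrFun h i))

noncomputable instance (d n : ℕ) : Fintype (LatticeBall d n) := Fintype.ofFinite _

instance (d n : ℕ) : DecidableEq (LatticeBall d n) := by
  unfold LatticeBall; infer_instance

/-- The kernel on the ball of the simple random walk on `ℤ^d` killed upon exiting it. -/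
noncomputable def latticeKernel (d n : ℕ) : LatticeBall d n → LatticeBall d n → ℝ≥0∞ :=
  fun x y => if (∑ i, |x.1 i - y.1 i|) = 1 then ((2 * d : ℕ) : ℝ≥0∞)⁻¹ else 0

/-- `g_d(n)`: `1` if `d = 1`, `n log n` if `d = 2`, `n^(d-1)` if `d ≥ 3`. -/
noncomputable def gFun (d : ℕ) (n : ℕ) : ℝ :=
  if d = 1 then 1 else if d = 2 then n * Real.log n else (n : ℝ) ^ (d - 1)

end ARW
namespace ARW

/-- The transition matrix of the ARW chain on the discrete Euclidean ball of radius
`√n` in `ℤ^d`, with simple random walk killed upon exiting the ball, uniform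
insertion law and sleeping rate `lam`. -/
noncomputable def arwBallMatrix (d n : ℕ) (lam : ℝ) :
    Matrix (LatticeBall d n → Bool) (LatticeBall d n → Bool) ℝ :=
  arwMatrix (latticeKernel d n) lam (unifLaw (LatticeBall d n))

end ARW

namespace ARW
set_option linter.all false
set_option linter.unusedSectionVars false
set_option linter.unusedSimpArgs false
set_option linter.unusedVariables false

section Abelian
variable {V : Type} [Fintype V] [DecidableEq V]

def actI (x : V) : Option (Option V) → Conf V → Conf V
  | none, η => if η x = Site.active 0 then Function.update η x Site.sleeping else η
  | some none, η => Function.update η x (η x).removeOne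
  | some (some y), η => addActiveAt (Function.update η x (η x).removeOne) y

noncomputable def wtI (K : V → V → ℝ≥0∞) (a b : ℝ≥0∞) (x : V) : Option (Option V) → ℝ≥0∞
  | none => a
  | some none => b * (1 - ∑ y, K x y)
  | some (some y) => b * K x y

noncomputable def lzOp (K : V → V → ℝ≥0∞) (a b : ℝ≥0∞) (x : V) (F : Conf V → ℝ≥0∞)
    (η : Conf V) : ℝ≥0∞ := ∑ i, wtI K a b x i * F (actI x i η)

theorem add_comm_conf (η : Conf V) (u v : V) :
    addActiveAt (addActiveAt η u) v = addActiveAt (addActiveAt η v) u := by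
  by_cases h : u = v
  · subst h; rfl
  · unfold addActiveAt
    rw [Function.update_of_ne (Ne.symm h), Function.update_of_ne h, Function.update_comm h]

theorem act_add (x u : V) (i : Option (Option V)) (η : Conf V) (h : (η x).isActive = true) :
    actI x i (addActiveAt η u) = addActiveAt (actI x i η) u := by
  obtain ⟨n, hn⟩ : ∃ n, η x = Site.active n := by
    cases hx : η x <;> simp_all [Site.isActive]
  have hrem : Function.update (addActiveAt η u) x ((addActiveAt η u) x).removeOne
      = addActiveAt (Function.update η x (η x).removeOne) u := by
    by_cases hux : u = x
    · subst hux
      cases n <;> simp [addActiveAt, hn, Site.addActive, Site.removeOne]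
    · unfold addActiveAt
      rw [Function.update_of_ne (Ne.symm hux), Function.update_of_ne hux, Function.update_comm hux]
  rcases i with _ | _ | y
  · by_cases hux : u = x
    · subst hux
      cases n <;> simp [actI, addActiveAt, hn, Site.addActive]
    · have : (addActiveAt η u) x = η x := by
        simp [addActiveAt, Function.update_of_ne (Ne.symm hux)]
      simp only [actI, this]
      split_ifs
      · unfold addActiveAt
        rw [Function.update_of_ne hux, Function.update_comm hux]
      · rfl
  · exact hrem
  · simp only [actI, hrem]
    exact add_comm_conf _ _ _

theorem act_active (x z : V) (hxz : x ≠ z) (i : Option (Option V)) (η : Conf V)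
    (h : (η z).isActive = true) : (actI x i η z).isActive = true := by
  have hadd : ∀ (σ : Conf V) (y : V), (σ z).isActive = true →
      (addActiveAt σ y z).isActive = true := by
    intro σ y hs
    by_cases hy : z = y
    · subst hy
      cases hc : σ z <;> simp_all [addActiveAt, Site.addActive, Site.isActive]
    · simpa [addActiveAt, Function.update_of_ne hy] using hs
  rcases i with _ | _ | y
  · simp only [actI]
    split_ifs
    · rwa [Function.update_of_ne (Ne.symm hxz)]
    · exact h
  · simp only [actI]; rwa [Function.update_of_ne (Ne.symm hxz)]
  · simp only [actI]; apply hadd; rwa [Function.update_of_ne (Ne.symm hxz)]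

theorem act_comm0 (x z : V) (hxz : x ≠ z) (i j : Option (Option V)) (hi : ∀ y, i ≠ some (some y))
    (hj : ∀ y, j ≠ some (some y)) (η : Conf V) :
    actI z j (actI x i η) = actI x i (actI z j η) := by
  rcases i with _ | _ | y <;> rcases j with _ | _ | y'
  all_goals first | (exact absurd rfl (hi _)) | (exact absurd rfl (hj _)) | skip
  all_goals
    simp only [actI]
    first | split_ifs | skip
    all_goals simp_all [Function.update_of_ne hxz, Function.update_of_ne (Ne.symm hxz)]
    all_goals try rw [Function.update_comm hxz]

theorem act_comm1 (x z : V) (hxz : x ≠ z) (i j : Option (Option V)) (hi : ∀ y, i ≠ some (some y))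
    (η : Conf V) (hx : (η x).isActive = true) (hz : (η z).isActive = true) :
    actI z j (actI x i η) = actI x i (actI z j η) := by
  rcases j with _ | _ | y
  · exact act_comm0 x z hxz i _ hi (by simp) η
  · exact act_comm0 x z hxz i _ hi (by simp) η
  · have h2 := act_comm0 x z hxz i (some none) hi (by simp) η
    have e : ∀ σ : Conf V, actI z (some (some y)) σ = addActiveAt (actI z (some none) σ) y :=
      fun _ => rfl
    rw [e, e, h2, act_add]
    exact act_active z x (Ne.symm hxz) _ _ hx

theorem act_comm (x z : V) (hxz : x ≠ z) (i j : Option (Option V))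
    (η : Conf V) (hx : (η x).isActive = true) (hz : (η z).isActive = true) :
    actI z j (actI x i η) = actI x i (actI z j η) := by
  rcases i with _ | _ | y
  · exact act_comm1 x z hxz _ j (by simp) η hx hz
  · exact act_comm1 x z hxz _ j (by simp) η hx hz
  · have h2 := act_comm1 x z hxz (some none) j (by simp) η hx hz
    have e : ∀ σ : Conf V, actI x (some (some y)) σ = addActiveAt (actI x (some none) σ) y :=
      fun _ => rfl
    rw [e, e, ← h2, act_add]
    exact act_active x z hxz _ _ hz

variable (K : V → V → ℝ≥0∞) (a b : ℝ≥0∞)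

theorem lz_comm (x z : V) (F : Conf V → ℝ≥0∞) (η : Conf V)
    (hx : (η x).isActive = true) (hz : (η z).isActive = true) :
    lzOp K a b x (lzOp K a b z F) η = lzOp K a b z (lzOp K a b x F) η := by
  by_cases hxz : x = z
  · subst hxz; rfl
  · unfold lzOp
    simp_rw [Finset.mul_sum]
    rw [Finset.sum_comm]
    refine Finset.sum_congr rfl fun j _ => Finset.sum_congr rfl fun i _ => ?_
    rw [act_comm x z hxz i j η hx hz]; ring

theorem lz_mono (x : V) {F G : Conf V → ℝ≥0∞} (h : ∀ σ, F σ ≤ G σ) (η : Conf V) :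
    lzOp K a b x F η ≤ lzOp K a b x G η :=
  Finset.sum_le_sum fun i _ => mul_le_mul_right (h _) _

theorem lz_congr (x : V) {F G : Conf V → ℝ≥0∞} {η : Conf V}
    (h : ∀ i, F (actI x i η) = G (actI x i η)) :
    lzOp K a b x F η = lzOp K a b x G η :=
  Finset.sum_congr rfl fun i _ => by rw [h]

/-- probability of lazy stabilization at `ξ` within `t` topplings. -/
noncomputable def hT (ξ : V → Bool) : ℕ → Conf V → ℝ≥0∞
  | 0 => fun σ => if σ = embed ξ then 1 else 0
  | t + 1 => fun σ => if h : (activeSites σ).Nonempty then lzOp K a b h.choose (hT ξ t) σ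
      else if σ = embed ξ then 1 else 0

theorem hT_act (ξ : V → Bool) (t : ℕ) (σ : Conf V) (h : (activeSites σ).Nonempty) :
    hT K a b ξ (t + 1) σ = lzOp K a b h.choose (hT K a b ξ t) σ := dif_pos h

theorem hT_nact (ξ : V → Bool) (t : ℕ) (σ : Conf V) (h : ¬ (activeSites σ).Nonempty) :
    hT K a b ξ (t + 1) σ = if σ = embed ξ then 1 else 0 := dif_neg h

theorem embed_not_active (ξ : V → Bool) : ¬ (activeSites (embed ξ)).Nonempty := by
  rintro ⟨x, hx⟩
  have hx' := (Finset.mem_filter.mp hx).2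
  cases h : ξ x <;> simp [Site.isActive, embed, h] at hx'

theorem not_active_embed (σ : Conf V) (h : ¬ (activeSites σ).Nonempty) :
    ∃ ζ, σ = embed ζ := by
  refine ⟨fun x => decide (σ x = Site.sleeping), ?_⟩
  funext x
  have hx : ¬ (σ x).isActive = true := fun hx => h ⟨x, by simp [activeSites, hx]⟩
  cases hs : σ x <;> simp_all [embed, Site.isActive]

theorem embed_inj {ξ ζ : V → Bool} (h : embed ξ = embed ζ) : ξ = ζ := by
  funext x
  have := congrFun h x
  cases h1 : ξ x <;> cases h2 : ζ x <;> simp_all [embed]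

theorem hT_mono1 (ξ : V → Bool) (t : ℕ) (σ : Conf V) : hT K a b ξ t σ ≤ hT K a b ξ (t + 1) σ := by
  induction t generalizing σ with
  | zero =>
    by_cases h : (activeSites σ).Nonempty
    · have : σ ≠ embed ξ := fun e => embed_not_active ξ (e ▸ h)
      simp [hT, this]
    · simp [hT, h]
  | succ t ih =>
    by_cases h : (activeSites σ).Nonempty
    · rw [hT_act K a b ξ _ σ h, hT_act K a b ξ _ σ h]
      exact lz_mono K a b _ ih σ
    · rw [hT_nact K a b ξ _ σ h, hT_nact K a b ξ _ σ h]

theorem hT_mono (ξ : V → Bool) (σ : Conf V) : Monotone fun t => hT K a b ξ t σ :=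
  monotone_nat_of_le_succ fun t => hT_mono1 K a b ξ t σ

theorem choose_active {σ : Conf V} (h : (activeSites σ).Nonempty) :
    (σ h.choose).isActive = true := by
  have := h.choose_spec
  simpa [activeSites] using this

theorem mem_ne {σ : Conf V} {x : V} (h : (σ x).isActive = true) : (activeSites σ).Nonempty :=
  ⟨x, by simp [activeSites, h]⟩

theorem hT_any (ξ : V → Bool) (t : ℕ) (σ : Conf V) (x : V) (hx : (σ x).isActive = true) :
    hT K a b ξ (t + 1) σ = lzOp K a b x (hT K a b ξ t) σ := by
  induction t generalizing σ x with
  | zero =>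
    have hne := mem_ne hx
    by_cases hc : hne.choose = x
    · rw [hT_act K a b ξ _ σ hne, hc]
    · have hca := choose_active hne
      have key : ∀ u v : V, u ≠ v → (σ v).isActive = true →
          lzOp K a b u (hT K a b ξ 0) σ = 0 := by
        intro u v huv hv
        refine Finset.sum_eq_zero fun i _ => ?_
        have : actI u i σ ≠ embed ξ := fun e =>
          embed_not_active ξ (e ▸ mem_ne (act_active u v huv i σ hv))
        simp [hT, this]
      rw [hT_act K a b ξ _ σ hne, key _ x hc hx, key _ _ (Ne.symm hc) hca]
  | succ t ih =>
    have hne := mem_ne hx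
    by_cases hc : hne.choose = x
    · rw [hT_act K a b ξ _ σ hne, hc]
    · have hca := choose_active hne
      rw [hT_act K a b ξ _ σ hne]
      rw [lz_congr K a b _ (fun i => ih (actI hne.choose i σ) x (act_active _ _ hc i σ hx)),
        lz_comm K a b _ _ _ _ hca hx]
      refine lz_congr K a b _ fun i => ?_
      exact (ih _ _ (act_active _ _ (Ne.symm hc) i σ hca)).symm

/-- probability of stabilization at `ξ`. -/
noncomputable def hI (ξ : V → Bool) (σ : Conf V) : ℝ≥0∞ := ⨆ t, hT K a b ξ t σ

theorem lz_iSup (x : V) (F : ℕ → Conf V → ℝ≥0∞) (hF : ∀ σ, Monotone fun t => F t σ) (η : Conf V) :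
    lzOp K a b x (fun σ => ⨆ t, F t σ) η = ⨆ t, lzOp K a b x (F t) η := by
  unfold lzOp
  simp_rw [ENNReal.mul_iSup]
  rw [ENNReal.finsetSum_iSup_of_monotone]
  intro i s t hst
  exact mul_le_mul_right (hF _ hst) _

theorem hI_any (ξ : V → Bool) (σ : Conf V) (x : V) (hx : (σ x).isActive = true) :
    hI K a b ξ σ = lzOp K a b x (hI K a b ξ) σ := by
  have : lzOp K a b x (hI K a b ξ) σ = ⨆ t, lzOp K a b x (hT K a b ξ t) σ :=
    lz_iSup K a b x (fun t => hT K a b ξ t) (hT_mono K a b ξ) σ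
  rw [this]
  simp_rw [← hT_any K a b ξ _ σ x hx]
  rw [hI]
  exact ((hT_mono K a b ξ σ).iSup_nat_add 1).symm

theorem hT_stable (ξ ζ : V → Bool) (t : ℕ) : hT K a b ξ t (embed ζ) = if ζ = ξ then 1 else 0 := by
  have e : (embed ζ = embed ξ) ↔ ζ = ξ := ⟨embed_inj, fun h => by rw [h]⟩
  cases t with
  | zero => simp [hT, e]
  | succ t => simp [hT, embed_not_active, e]

theorem hI_stable (ξ ζ : V → Bool) : hI K a b ξ (embed ζ) = if ζ = ξ then 1 else 0 := by
  simp [hI, hT_stable]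

end Abelian
end ARW

namespace ARW
set_option linter.unusedSectionVars false
set_option linter.unusedSimpArgs false
set_option linter.unusedVariables false

section Stab
variable {V : Type} [Fintype V] [DecidableEq V]
variable (K : V → V → ℝ≥0∞) (a b : ℝ≥0∞)

noncomputable def mvOp (x : V) (F : Conf V → ℝ≥0∞) (η : Conf V) : ℝ≥0∞ :=
  (∑ y, K x y * F (addActiveAt (Function.update η x (η x).removeOne) y)) +
    (1 - ∑ y, K x y) * F (Function.update η x (η x).removeOne)

theorem lz_eq (x : V) (F : Conf V → ℝ≥0∞) (η : Conf V) :
    lzOp K a b x F η = a * F (actI x none η) + b * mvOp K x F η := by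
  unfold lzOp mvOp
  rw [Fintype.sum_option, Fintype.sum_option]
  simp only [wtI, actI, mul_add, Finset.mul_sum]
  congr 1
  rw [add_comm]
  simp only [mul_assoc]

theorem lz_one (hK : SubStochastic K) (hab : a + b = 1) (x : V) (η : Conf V) :
    lzOp K a b x (fun _ => 1) η = 1 := by
  rw [lz_eq]
  simp only [mvOp, mul_one]
  rw [add_tsub_cancel_of_le (hK x), mul_one, hab]

theorem hT_le_one (hK : SubStochastic K) (hab : a + b = 1) (ξ : V → Bool) (t : ℕ) (σ : Conf V) :
    hT K a b ξ t σ ≤ 1 := by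
  induction t generalizing σ with
  | zero => simp only [hT]; split_ifs <;> simp
  | succ t ih =>
    by_cases h : (activeSites σ).Nonempty
    · rw [hT_act K a b ξ t σ h]
      calc _ ≤ lzOp K a b h.choose (fun _ => 1) σ := lz_mono K a b _ ih σ
        _ = 1 := lz_one K a b hK hab _ _
    · rw [hT_nact K a b ξ t σ h]; split_ifs <;> simp

theorem hI_le_one (hK : SubStochastic K) (hab : a + b = 1) (ξ : V → Bool) (σ : Conf V) :
    hI K a b ξ σ ≤ 1 := iSup_le fun t => hT_le_one K a b hK hab ξ t σ

theorem fix_cancel (hab : a + b = 1) (hb : b ≠ 0) {u v : ℝ≥0∞} (hu : u ≤ 1)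
    (h : u = a * u + b * v) : u = v := by
  have ha1 : a ≤ 1 := hab ▸ le_self_add
  have hb1 : b ≤ 1 := hab ▸ le_add_self
  have h1 : a * u + b * u = a * u + b * v := by
    rw [← add_mul, hab, one_mul]; exact h
  have hne : a * u ≠ ⊤ :=
    ENNReal.mul_ne_top (ne_top_of_le_ne_top ENNReal.one_ne_top ha1)
      (ne_top_of_le_ne_top ENNReal.one_ne_top hu)
  have h2 := (ENNReal.add_right_inj hne).1 h1
  exact (ENNReal.mul_right_inj hb (ne_top_of_le_ne_top ENNReal.one_ne_top hb1)).1 h2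

theorem hI_mv (hK : SubStochastic K) (hab : a + b = 1) (hb : b ≠ 0) (ξ : V → Bool) (σ : Conf V)
    (x : V) (hx : (σ x).isActive = true) (hx0 : σ x ≠ Site.active 0) :
    hI K a b ξ σ = mvOp K x (hI K a b ξ) σ := by
  have h := hI_any K a b ξ σ x hx
  rw [lz_eq] at h
  simp only [actI, hx0, if_false] at h
  exact fix_cancel a b hab hb (hI_le_one K a b hK hab ξ σ) h

/-! relation with the kernel -/

theorem topple_sum (lam : ℝ) (F : Conf V → ℝ≥0∞) (η : Conf V) (h : (activeSites η).Nonempty) :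
    ∑' σ, toppleKernel K lam η σ * F σ =
      if η h.choose = Site.active 0 then
        lzOp K (ENNReal.ofReal lam / (ENNReal.ofReal lam + 1)) (1 / (ENNReal.ofReal lam + 1))
          h.choose F η
      else mvOp K h.choose F η := by
  have hmv : ∑' σ, ((∑ y, if σ = addActiveAt (Function.update η h.choose (η h.choose).removeOne) y
        then K h.choose y else 0) + (if σ = Function.update η h.choose (η h.choose).removeOne
        then 1 - ∑ y, K h.choose y else 0)) * F σ = mvOp K h.choose F η := by
    simp only [add_mul, Finset.sum_mul, ite_mul, zero_mul]
    rw [ENNReal.tsum_add, Summable.tsum_finsetSum (fun _ _ => ENNReal.summable)]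
    unfold mvOp
    congr 1
    · refine Finset.sum_congr rfl fun y _ => ?_
      rw [tsum_eq_single (addActiveAt (Function.update η h.choose (η h.choose).removeOne) y)]
      · simp
      · intro σ hσ; simp [hσ]
    · rw [tsum_eq_single (Function.update η h.choose (η h.choose).removeOne)]
      · simp
      · intro σ hσ; simp [hσ]
  simp only [toppleKernel, dif_pos h]
  split_ifs with h0
  · rw [lz_eq, ← hmv]
    simp only [actI, if_pos h0]
    simp only [add_assoc, div_eq_mul_inv, one_mul]
    have : ∀ σ, ((if σ = Function.update η h.choose Site.sleeping then ENNReal.ofReal lam else 0) +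
        ((∑ y, if σ = addActiveAt (Function.update η h.choose (η h.choose).removeOne) y
        then K h.choose y else 0) + (if σ = Function.update η h.choose (η h.choose).removeOne
        then 1 - ∑ y, K h.choose y else 0))) * (ENNReal.ofReal lam + 1)⁻¹ * F σ
        = (ENNReal.ofReal lam + 1)⁻¹ *
        (if σ = Function.update η h.choose Site.sleeping then ENNReal.ofReal lam * F σ else 0) +
        (ENNReal.ofReal lam + 1)⁻¹ *
        (((∑ y, if σ = addActiveAt (Function.update η h.choose (η h.choose).removeOne) y
        then K h.choose y else 0) + (if σ = Function.update η h.choose (η h.choose).removeOne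
        then 1 - ∑ y, K h.choose y else 0)) * F σ) := by
      intro σ
      split_ifs <;> ring
    rw [tsum_congr this, ENNReal.tsum_add, ENNReal.tsum_mul_left, ENNReal.tsum_mul_left]
    congr 1
    rw [tsum_eq_single (Function.update η h.choose Site.sleeping)]
    · simp only [if_true]; ring
    · intro σ hσ; simp [hσ]
  · exact hmv

theorem topple_sum_stable (lam : ℝ) (F : Conf V → ℝ≥0∞) (η : Conf V)
    (h : ¬ (activeSites η).Nonempty) : ∑' σ, toppleKernel K lam η σ * F σ = F η := by
  simp only [toppleKernel, dif_neg h]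
  rw [tsum_eq_single η]
  · simp
  · intro σ hσ; simp [hσ]

theorem kp_succ (lam : ℝ) (ξ : V → Bool) (t : ℕ) (η : Conf V) :
    kernelPow (toppleKernel K lam) (t + 1) η (embed ξ) =
      ∑' σ, toppleKernel K lam η σ * kernelPow (toppleKernel K lam) t σ (embed ξ) := rfl

theorem kp_stable (lam : ℝ) (ξ : V → Bool) (t : ℕ) (η : Conf V)
    (h : ¬ (activeSites η).Nonempty) :
    kernelPow (toppleKernel K lam) t η (embed ξ) = if η = embed ξ then 1 else 0 := by
  induction t with
  | zero => simp only [kernelPow]; congr 1; simp [eq_comm]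
  | succ t ih =>
    rw [kp_succ, topple_sum_stable K lam (fun σ => kernelPow (toppleKernel K lam) t σ (embed ξ))
      η h, ih]

theorem mv_mono (x : V) {F G : Conf V → ℝ≥0∞} (h : ∀ σ, F σ ≤ G σ) (η : Conf V) :
    mvOp K x F η ≤ mvOp K x G η := by
  unfold mvOp
  gcongr
  · exact h _
  · exact h _

theorem kp_mono1 (lam : ℝ) (ξ : V → Bool) (t : ℕ) (η : Conf V) :
    kernelPow (toppleKernel K lam) t η (embed ξ) ≤
      kernelPow (toppleKernel K lam) (t + 1) η (embed ξ) := by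
  induction t generalizing η with
  | zero =>
    by_cases h : (activeSites η).Nonempty
    · have : embed ξ ≠ η := fun e => embed_not_active ξ (e ▸ h)
      simp [kernelPow, this]
    · rw [kp_stable K lam ξ _ η h, kp_stable K lam ξ _ η h]
  | succ t ih =>
    rw [kernelPow, kernelPow]
    exact ENNReal.tsum_le_tsum fun σ => mul_le_mul_right (ih σ) _

theorem mv_iSup (x : V) (F : ℕ → Conf V → ℝ≥0∞) (hF : ∀ σ, Monotone fun t => F t σ) (η : Conf V) :
    mvOp K x (fun σ => ⨆ t, F t σ) η = ⨆ t, mvOp K x (F t) η := by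
  have := lz_iSup K 0 1 x F hF η
  simpa [lz_eq] using this

theorem lam_ab (lam : ℝ) (hl : 0 < lam) :
    ENNReal.ofReal lam / (ENNReal.ofReal lam + 1) + 1 / (ENNReal.ofReal lam + 1) = 1 := by
  rw [← ENNReal.add_div]
  exact ENNReal.div_self (by simp) (by simp)

theorem kp_sup (hK : SubStochastic K) (lam : ℝ) (hl : 0 < lam) (ξ : V → Bool) (η : Conf V) :
    ⨆ t, kernelPow (toppleKernel K lam) t η (embed ξ) =
      hI K (ENNReal.ofReal lam / (ENNReal.ofReal lam + 1)) (1 / (ENNReal.ofReal lam + 1)) ξ η := by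
  have hab := lam_ab lam hl
  have hb : (1 / (ENNReal.ofReal lam + 1)) ≠ 0 := by simp
  set a := ENNReal.ofReal lam / (ENNReal.ofReal lam + 1) with ha_def
  set b := 1 / (ENNReal.ofReal lam + 1) with hb_def
  apply le_antisymm
  · refine iSup_le fun t => ?_
    induction t generalizing η with
    | zero =>
      refine le_trans ?_ (le_iSup _ 0)
      simp only [kernelPow, hT]
      simp [eq_comm]
    | succ t ih =>
      by_cases h : (activeSites η).Nonempty
      · rw [kp_succ, topple_sum K lam (fun σ => kernelPow (toppleKernel K lam) t σ (embed ξ)) η h]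
        split_ifs with h0
        · rw [hI_any K a b ξ η _ (choose_active h)]
          exact lz_mono K a b _ ih η
        · rw [hI_mv K a b hK hab hb ξ η _ (choose_active h) h0]
          exact mv_mono K _ ih η
      · obtain ⟨ζ, rfl⟩ := not_active_embed η h
        rw [kp_stable K lam ξ _ _ h, hI_stable]
        by_cases e : ζ = ξ
        · simp [e]
        · simp [e, show embed ζ ≠ embed ξ from fun h => e (embed_inj h)]
  · refine iSup_le fun t => ?_
    have hmono : ∀ σ : Conf V, Monotone fun t => kernelPow (toppleKernel K lam) t σ (embed ξ) :=
      fun σ => monotone_nat_of_le_succ fun t => kp_mono1 K lam ξ t σ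
    induction t generalizing η with
    | zero =>
      refine le_trans ?_ (le_iSup _ 0)
      simp only [kernelPow, hT]
      simp [eq_comm]
    | succ t ih =>
      by_cases h : (activeSites η).Nonempty
      · rw [hT_act K a b ξ t η h]
        refine le_trans (lz_mono K a b _ ih η) ?_
        have hstep : ∀ t, kernelPow (toppleKernel K lam) (t+1) η (embed ξ) =
            if η h.choose = Site.active 0 then
              lzOp K a b h.choose (fun σ => kernelPow (toppleKernel K lam) t σ (embed ξ)) η
            else mvOp K h.choose (fun σ => kernelPow (toppleKernel K lam) t σ (embed ξ)) η :=
          fun t => topple_sum K lam (fun σ => kernelPow (toppleKernel K lam) t σ (embed ξ)) η h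
        by_cases h0 : η h.choose = Site.active 0
        · rw [lz_iSup K a b _ (fun t σ => kernelPow (toppleKernel K lam) t σ (embed ξ)) hmono]
          refine iSup_le fun t => ?_
          refine le_trans (le_of_eq ?_) (le_iSup _ (t+1))
          rw [hstep, if_pos h0]
        · rw [lz_eq, mv_iSup K _ (fun t σ => kernelPow (toppleKernel K lam) t σ (embed ξ)) hmono]
          have e1 : actI h.choose none η = η := by simp [actI, h0]
          rw [e1]
          have e2 : (⨆ t, mvOp K h.choose
              (fun σ => kernelPow (toppleKernel K lam) t σ (embed ξ)) η) ≤
              ⨆ t, kernelPow (toppleKernel K lam) t η (embed ξ) := by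
            refine iSup_le fun t => ?_
            refine le_trans (le_of_eq ?_) (le_iSup _ (t+1))
            rw [hstep, if_neg h0]
          calc _ ≤ a * (⨆ t, kernelPow (toppleKernel K lam) t η (embed ξ)) +
                b * (⨆ t, kernelPow (toppleKernel K lam) t η (embed ξ)) := by gcongr
            _ = _ := by rw [← add_mul, hab, one_mul]
      · rw [hT_nact K a b ξ t η h]
        refine le_trans (le_of_eq ?_) (le_iSup _ 0)
        rw [kp_stable K lam ξ _ _ h]

/-! composition -/

theorem add_active (σ : Conf V) (x z : V) (h : (σ z).isActive = true) :
    (addActiveAt σ x z).isActive = true := by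
  by_cases hy : z = x
  · subst hy
    cases hc : σ z <;> simp_all [addActiveAt, Site.addActive, Site.isActive]
  · simpa [addActiveAt, Function.update_of_ne hy] using h

theorem add_active_self (σ : Conf V) (x : V) : (addActiveAt σ x x).isActive = true := by
  cases hc : σ x <;> simp_all [addActiveAt, Site.addActive, Site.isActive]

theorem lz_add (z x : V) (F : Conf V → ℝ≥0∞) (σ : Conf V) (h : (σ z).isActive = true) :
    lzOp K a b z (fun τ => F (addActiveAt τ x)) σ = lzOp K a b z F (addActiveAt σ x) := by
  unfold lzOp
  refine Finset.sum_congr rfl fun i _ => ?_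
  rw [act_add z x i σ h]

theorem lz_sum {ι : Type} [Fintype ι] (z : V) (F : ι → Conf V → ℝ≥0∞) (c : ι → ℝ≥0∞) (σ : Conf V) :
    lzOp K a b z (fun τ => ∑ i, F i τ * c i) σ = ∑ i, lzOp K a b z (F i) σ * c i := by
  unfold lzOp
  simp_rw [Finset.mul_sum, Finset.sum_mul]
  rw [Finset.sum_comm]
  simp only [mul_assoc]

theorem hI_comp (ξ : V → Bool) (σ : Conf V) (x : V) :
    ∑ ζ, hI K a b ζ σ * hI K a b ξ (addActiveAt (embed ζ) x) =
      hI K a b ξ (addActiveAt σ x) := by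
  have stab : ∀ ζ0 : V → Bool, ∑ ζ, hI K a b ζ (embed ζ0) * hI K a b ξ (addActiveAt (embed ζ) x) =
      hI K a b ξ (addActiveAt (embed ζ0) x) := by
    intro ζ0; simp [hI_stable]
  apply le_antisymm
  · have hs : ∑ ζ, hI K a b ζ σ * hI K a b ξ (addActiveAt (embed ζ) x) =
        ⨆ t, ∑ ζ, hT K a b ζ t σ * hI K a b ξ (addActiveAt (embed ζ) x) := by
      rw [← ENNReal.finsetSum_iSup_of_monotone]
      · refine Finset.sum_congr rfl fun ζ _ => ?_
        rw [hI, ENNReal.iSup_mul]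
      · intro ζ s t hst
        exact mul_le_mul_left (hT_mono K a b ζ σ hst) _
    rw [hs]
    refine iSup_le fun t => ?_
    clear hs
    by_cases hst : (activeSites σ).Nonempty
    swap
    · obtain ⟨ζ, rfl⟩ := not_active_embed σ hst
      simp [hT_stable]
    induction t generalizing σ with
    | zero =>
      have : ∀ ζ, σ ≠ embed ζ := fun ζ e => embed_not_active ζ (e ▸ hst)
      simp [hT, this]
    | succ t ih =>
      have hz := choose_active hst
      simp_rw [fun ζ => hT_act K a b ζ t σ hst]
      rw [← lz_sum, hI_any K a b ξ _ _ (add_active σ x _ hz), ← lz_add K a b _ x _ σ hz]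
      apply lz_mono
      intro τ
      by_cases hst' : (activeSites τ).Nonempty
      · exact ih τ hst'
      · obtain ⟨ζ, rfl⟩ := not_active_embed τ hst'
        simp [hT_stable]
  · rw [hI]
    refine iSup_le fun t => ?_
    induction t generalizing σ with
    | zero =>
      have : addActiveAt σ x ≠ embed ξ := fun e =>
        embed_not_active ξ (e ▸ mem_ne (add_active_self σ x))
      simp [hT, this]
    | succ t ih =>
      by_cases hst : (activeSites σ).Nonempty
      · have hz := choose_active hst
        rw [hT_any K a b ξ t _ _ (add_active σ x _ hz), ← lz_add K a b _ x _ σ hz]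
        refine le_trans (lz_mono K a b _ ih σ) ?_
        rw [lz_sum]
        refine le_of_eq (Finset.sum_congr rfl fun ζ _ => ?_)
        rw [← hI_any K a b ζ σ _ hz]
      · obtain ⟨ζ, rfl⟩ := not_active_embed σ hst
        rw [stab]
        exact le_iSup (fun t => hT K a b ξ t (addActiveAt (embed ζ) x)) (t+1)

/-! particle count -/

def scnt : Site → ℕ
  | .empty => 0
  | .sleeping => 1
  | .active n => n + 1

def tcnt (σ : Conf V) : ℕ := ∑ x, scnt (σ x)

theorem tcnt_update (σ : Conf V) (x : V) (s : Site) :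
    tcnt (Function.update σ x s) + scnt (σ x) = tcnt σ + scnt s := by
  unfold tcnt
  rw [← Finset.add_sum_erase _ _ (Finset.mem_univ x),
    ← Finset.add_sum_erase _ (fun x => scnt (σ x)) (Finset.mem_univ x)]
  have : ∑ y ∈ Finset.univ.erase x, scnt (Function.update σ x s y) =
      ∑ y ∈ Finset.univ.erase x, scnt (σ y) :=
    Finset.sum_congr rfl fun y hy => by rw [Function.update_of_ne (Finset.ne_of_mem_erase hy)]
  rw [this]
  simp
  ring

theorem tcnt_add (σ : Conf V) (x : V) : tcnt (addActiveAt σ x) = tcnt σ + 1 := by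
  have := tcnt_update σ x (σ x).addActive
  unfold addActiveAt
  cases h : σ x <;> simp_all [scnt, Site.addActive] <;> omega

theorem tcnt_rem (σ : Conf V) (x : V) (h : (σ x).isActive = true) :
    tcnt (Function.update σ x (σ x).removeOne) + 1 = tcnt σ := by
  have := tcnt_update σ x (σ x).removeOne
  cases hs : σ x with
  | empty => simp_all [Site.isActive]
  | sleeping => simp_all [Site.isActive]
  | active n => cases n <;> simp_all [scnt, Site.removeOne] <;> omega

theorem tcnt_act (σ : Conf V) (x : V) (h : (σ x).isActive = true) (i : Option (Option V)) :
    tcnt (actI x i σ) ≤ tcnt σ := by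
  have hr := tcnt_rem σ x h
  rcases i with _ | _ | y
  · simp only [actI]
    split_ifs with h0
    · have := tcnt_update σ x Site.sleeping
      simp [h0, scnt] at this
      omega
    · exact le_rfl
  · simp only [actI]; omega
  · simp only [actI, tcnt_add]; omega

theorem hI_cnt (ξ : V → Bool) (σ : Conf V) (h : tcnt σ < tcnt (embed ξ)) : hI K a b ξ σ = 0 := by
  rw [hI, ENNReal.iSup_eq_zero]
  intro t
  induction t generalizing σ with
  | zero =>
    have : σ ≠ embed ξ := by rintro rfl; omega
    simp [hT, this]
  | succ t ih =>
    by_cases hst : (activeSites σ).Nonempty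
    · rw [hT_act K a b ξ t σ hst]
      refine Finset.sum_eq_zero fun i _ => ?_
      rw [ih _ (lt_of_le_of_lt (tcnt_act σ _ (choose_active hst) i) h), mul_zero]
    · have : σ ≠ embed ξ := by rintro rfl; omega
      simp [hT_nact K a b ξ t σ hst, this]

/-! positivity -/

/-- active particles on `A`, sleeping particles of `η` elsewhere -/
def sg (A : Finset V) (η : V → Bool) : Conf V :=
  fun x => if x ∈ A then Site.active 0 else embed η x

theorem sg_empty (η : V → Bool) : sg ∅ η = embed η := by
  funext x; simp [sg]

theorem hI_pos_add (hK : SubStochastic K) (hND : NonDegenerate K) (hb : b ≠ 0) (ξ : V → Bool)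
    (τ : Conf V) (hs : ∀ x, τ x ≠ Site.sleeping) (h : hI K a b ξ τ ≠ 0) (z : V) :
    hI K a b ξ (addActiveAt τ z) ≠ 0 := by
  intro h0
  set Z : Finset V := Finset.univ.filter fun x => hI K a b ξ (addActiveAt τ x) = 0 with hZ
  have hne : Z.Nonempty := ⟨z, by simp [hZ, h0]⟩
  obtain ⟨x, hxZ, hx⟩ := hND Z hne
  have hx0 : hI K a b ξ (addActiveAt τ x) = 0 := by simpa [hZ] using hxZ
  rw [hI_any K a b ξ _ x (add_active_self τ x), lz_eq] at hx0
  have hrem : Function.update (addActiveAt τ x) x ((addActiveAt τ x) x).removeOne = τ := by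
    have : (addActiveAt τ x x).removeOne = τ x := by
      cases hc : τ x with
      | empty => simp [addActiveAt, hc, Site.addActive, Site.removeOne]
      | sleeping => exact absurd hc (hs x)
      | active n => simp [addActiveAt, hc, Site.addActive, Site.removeOne]
    rw [this]; simp [addActiveAt]
  simp only [mvOp, hrem] at hx0
  have h1 := (add_eq_zero.1 hx0).2
  rcases mul_eq_zero.1 h1 with h1 | h1
  · exact hb h1
  obtain ⟨h2, h3⟩ := add_eq_zero.1 h1
  have h4 : 1 - ∑ y, K x y = 0 := (mul_eq_zero.1 h3).resolve_right h
  have h5 : ∑ y, K x y = 1 := le_antisymm (hK x) (tsub_eq_zero_iff_le.1 h4)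
  apply hx
  rw [← h5]
  refine Finset.sum_subset (Finset.subset_univ _) fun y _ hy => ?_
  have hy' : hI K a b ξ (addActiveAt τ y) ≠ 0 := by simpa [hZ] using hy
  have := (Finset.sum_eq_zero_iff.1 h2) y (Finset.mem_univ y)
  exact (mul_eq_zero.1 this).resolve_right hy'

theorem hI_pos (hK : SubStochastic K) (hND : NonDegenerate K) (ha : a ≠ 0) (hb : b ≠ 0)
    (ξ : V → Bool) (η : V → Bool) : hI K a b ξ (sg Finset.univ η) ≠ 0 := by
  -- sleeping phase
  have h1 : ∀ C : Finset V, C ⊆ Finset.univ.filter (fun x => ξ x = true) →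
      hI K a b ξ (sg C ξ) ≠ 0 := by
    intro C
    induction C using Finset.induction_on with
    | empty => intro _; rw [sg_empty, hI_stable]; simp
    | insert x C hx ih =>
      intro hC
      have hxt : ξ x = true := by
        have := hC (Finset.mem_insert_self x C)
        simpa using this
      rw [hI_any K a b ξ _ x (by simp [sg, Site.isActive]), lz_eq]
      have e : actI x none (sg (insert x C) ξ) = sg C ξ := by
        have e0 : sg (insert x C) ξ x = Site.active 0 := by simp [sg]
        simp only [actI, e0, if_true]
        funext y
        by_cases hy : y = x
        · subst hy; simp [sg, hx, embed, hxt]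
        · rw [Function.update_of_ne hy]; simp [sg, hy]
      rw [e]
      intro h0
      exact (mul_ne_zero ha (ih (fun y hy => hC (Finset.mem_insert_of_mem hy)))) (add_eq_zero.1 h0).1
  set C0 : Finset V := Finset.univ.filter (fun x => ξ x = true) with hC0
  have h2 : ∀ D : Finset V, hI K a b ξ (sg (C0 ∪ D) (fun _ => false)) ≠ 0 := by
    intro D
    induction D using Finset.induction_on with
    | empty =>
      have : sg (C0 ∪ ∅) (fun _ => false) = sg C0 ξ := by
        funext y; by_cases hy : ξ y = true <;> simp [sg, hC0, hy, embed]
      rw [this]; exact h1 C0 (le_refl _)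
    | insert x D hx ih =>
      by_cases hxC : x ∈ C0
      · have : C0 ∪ insert x D = C0 ∪ D := by
          ext y; simp; intro h; subst h; exact Or.inl hxC
        rw [this]; exact ih
      · have e : sg (C0 ∪ insert x D) (fun _ => false) =
            addActiveAt (sg (C0 ∪ D) (fun _ => false)) x := by
          funext y
          by_cases hy : y = x
          · subst hy; simp [sg, addActiveAt, hxC, hx, embed, Site.addActive]
          · rw [addActiveAt, Function.update_of_ne hy]; simp [sg, hy]
        rw [e]
        refine hI_pos_add K a b hK hND hb ξ _ ?_ ih x
        intro y; unfold sg; split_ifs <;> simp [embed]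
  have := h2 Finset.univ
  have e : sg (C0 ∪ Finset.univ) (fun _ => false) = sg Finset.univ η := by
    funext y; simp [sg]
  rwa [e] at this

end Stab
end ARW

namespace ARW
set_option linter.unusedSectionVars false
set_option linter.unusedSimpArgs false
set_option linter.unusedVariables false

section Chain
variable {V : Type} [Fintype V] [DecidableEq V]
variable (K : V → V → ℝ≥0∞) (a b : ℝ≥0∞)

theorem K_ne_top {K : V → V → ℝ≥0∞} (hK : SubStochastic K) (x y : V) : K x y ≠ ⊤ :=
  ne_top_of_le_ne_top ENNReal.one_ne_top
    ((Finset.single_le_sum (f := fun y => K x y) (fun _ _ => zero_le) (Finset.mem_univ y)).trans (hK x))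

theorem kR_sum_le {K : V → V → ℝ≥0∞} (hK : SubStochastic K) (x : V) : ∑ y, (K x y).toReal ≤ 1 := by
  rw [← ENNReal.toReal_sum fun y _ => K_ne_top hK x y]
  exact ENNReal.toReal_le_of_le_ofReal zero_le_one (by simpa using hK x)

theorem min_principle {K : V → V → ℝ≥0∞} (hK : SubStochastic K) (hND : NonDegenerate K)
    (A : Finset V) (D : V → ℝ) (h1 : ∀ z ∈ A, ∑ y, (K z y).toReal * D y ≤ D z)
    (h2 : ∀ z, z ∉ A → 0 ≤ D z) (z : V) : 0 ≤ D z := by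
  by_contra hz
  push Not at hz
  have : Nonempty V := ⟨z⟩
  obtain ⟨z0, hz0⟩ := Finite.exists_min D
  have hm : D z0 < 0 := lt_of_le_of_lt (hz0 z) hz
  set S : Finset V := Finset.univ.filter fun y => D y = D z0 with hS
  obtain ⟨x, hxS, hx⟩ := hND S ⟨z0, by simp [hS]⟩
  have hxe : D x = D z0 := by simpa [hS] using hxS
  have hxA : x ∈ A := by
    by_contra h
    have := h2 x h
    linarith
  have h3 := h1 x hxA
  have hs := kR_sum_le hK x
  have h4 : ∑ y, (K x y).toReal * (D y - D z0) ≤ D z0 * (1 - ∑ y, (K x y).toReal) := by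
    simp only [mul_sub, Finset.sum_sub_distrib, ← Finset.sum_mul]
    linarith
  have h5 : ∀ y ∈ Finset.univ, 0 ≤ (K x y).toReal * (D y - D z0) := fun y _ =>
    mul_nonneg ENNReal.toReal_nonneg (sub_nonneg.2 (hz0 y))
  have h6 := Finset.sum_nonneg h5
  have h7 : D z0 * (1 - ∑ y, (K x y).toReal) ≤ 0 :=
    mul_nonpos_of_nonpos_of_nonneg hm.le (by linarith)
  have h8 : ∑ y, (K x y).toReal * (D y - D z0) = 0 := by linarith
  have h9 : ∑ y, (K x y).toReal = 1 := by
    have : D z0 * (1 - ∑ y, (K x y).toReal) = 0 := by linarith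
    rcases mul_eq_zero.1 this with h | h <;> linarith
  have h10 := (Finset.sum_eq_zero_iff_of_nonneg h5).1 h8
  have h11 : ∑ y ∈ S, (K x y).toReal = 1 := by
    rw [← h9]
    refine Finset.sum_subset (Finset.subset_univ _) fun y _ hy => ?_
    have hy' : D y ≠ D z0 := by simpa [hS] using hy
    exact (mul_eq_zero.1 (h10 y (Finset.mem_univ y))).resolve_right (sub_ne_zero.2 hy')
  rw [← ENNReal.toReal_sum fun y _ => K_ne_top hK x y] at h11
  apply hx
  have := (ENNReal.toReal_eq_one_iff _).1 h11
  exact this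

noncomputable def hR (ξ : V → Bool) (σ : Conf V) : ℝ := (hI K a b ξ σ).toReal

theorem hI_ne_top (hK : SubStochastic K) (hab : a + b = 1) (ξ : V → Bool) (σ : Conf V) :
    hI K a b ξ σ ≠ ⊤ := ne_top_of_le_ne_top ENNReal.one_ne_top (hI_le_one K a b hK hab ξ σ)

def Harm (g : Conf V → ℝ) : Prop := ∀ (σ : Conf V) (x : V), (σ x).isActive = true →
  σ x ≠ Site.active 0 → g σ =
    (∑ y, (K x y).toReal * g (addActiveAt (Function.update σ x (σ x).removeOne) y)) +
      (1 - ∑ y, (K x y).toReal) * g (Function.update σ x (σ x).removeOne)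

theorem hR_harm (hK : SubStochastic K) (hab : a + b = 1) (hb : b ≠ 0) (ξ : V → Bool) :
    Harm K (hR K a b ξ) := by
  intro σ x h1 h2
  have hk := K_ne_top hK
  have hi := hI_ne_top K a b hK hab ξ
  unfold hR
  rw [hI_mv K a b hK hab hb ξ σ x h1 h2, mvOp, ENNReal.toReal_add, ENNReal.toReal_sum,
    ENNReal.toReal_mul, ENNReal.toReal_sub_of_le (hK x) ENNReal.one_ne_top,
    ENNReal.toReal_sum fun y _ => hk x y]
  · simp [ENNReal.toReal_mul]
  · intro y _; exact ENNReal.mul_ne_top (hk x y) (hi _)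
  · exact ENNReal.sum_ne_top.2 fun y _ => ENNReal.mul_ne_top (hk x y) (hi _)
  · exact ENNReal.mul_ne_top (ne_top_of_le_ne_top ENNReal.one_ne_top tsub_le_self) (hi _)

theorem harm_sum {ι : Type} [Fintype ι] (g : ι → Conf V → ℝ) (c : ι → ℝ) (h : ∀ i, Harm K (g i)) :
    Harm K (fun σ => ∑ i, g i σ * c i) := by
  intro σ x h1 h2
  simp only
  rw [Finset.sum_congr rfl fun i _ => by rw [h i σ x h1 h2]]
  simp only [add_mul, Finset.sum_add_distrib, Finset.sum_mul, Finset.mul_sum]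
  rw [Finset.sum_comm]
  simp only [mul_assoc]

theorem add_rem_of (τ τ' : Conf V) (x : V) (h : ∀ y, y ≠ x → τ y = τ' y)
    (hx : (τ x).addActive.removeOne = τ' x) :
    Function.update (addActiveAt τ x) x ((addActiveAt τ x) x).removeOne = τ' := by
  funext y
  by_cases hy : y = x
  · subst hy; simp [addActiveAt, hx]
  · rw [Function.update_of_ne hy, addActiveAt, Function.update_of_ne hy, h y hy]

theorem step_lower {K : V → V → ℝ≥0∞} (hK : SubStochastic K) (hND : NonDegenerate K)
    (g : Conf V → ℝ) (hg : Harm K g) (η : V → Bool) (R : Finset V → ℝ) (W : Finset V → V → ℝ)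
    (hR : ∀ A, R A ≤ g (sg A η))
    (hi : ∀ A z, z ∉ A → W A z ≤ R (insert z A))
    (hii : ∀ A z, z ∈ A → W A z ≤ ∑ y, (K z y).toReal * W A y + (1 - ∑ y, (K z y).toReal) * R A)
    (hiii : ∀ A z, z ∉ A → W A z ≤ W (insert z A) z) (A : Finset V) (z : V) :
    W A z ≤ g (addActiveAt (sg A η) z) := by
  induction hn : (Aᶜ).card using Nat.strong_induction_on generalizing A z with
  | _ n ih =>
  have key : 0 ≤ g (addActiveAt (sg A η) z) - W A z := by
    refine min_principle hK hND A (fun z => g (addActiveAt (sg A η) z) - W A z) ?_ ?_ z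
    · intro z hz
      have hrem : Function.update (addActiveAt (sg A η) z) z ((addActiveAt (sg A η) z) z).removeOne
          = sg A η := add_rem_of _ _ z (fun _ _ => rfl)
            (by simp [sg, hz, Site.addActive, Site.removeOne])
      have h := hg (addActiveAt (sg A η) z) z (add_active_self _ _)
        (by simp [addActiveAt, sg, hz, Site.addActive])
      rw [hrem] at h
      rw [h]
      have h2 := hii A z hz
      have h3 : (1 - ∑ y, (K z y).toReal) * R A ≤ (1 - ∑ y, (K z y).toReal) * g (sg A η) :=
        mul_le_mul_of_nonneg_left (hR A) (by linarith [kR_sum_le hK z])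
      simp only [mul_sub, Finset.sum_sub_distrib]
      linarith
    · intro z hz
      simp only [sub_nonneg]
      by_cases hηz : η z = true
      · have hrem : Function.update (addActiveAt (sg A η) z) z
            ((addActiveAt (sg A η) z) z).removeOne = sg (insert z A) η :=
          add_rem_of _ _ z (fun y hy => by simp [sg, hy])
            (by simp [sg, hz, hηz, embed, Site.addActive, Site.removeOne])
        have h := hg (addActiveAt (sg A η) z) z (add_active_self _ _)
          (by simp [addActiveAt, sg, hz, hηz, embed, Site.addActive])
        rw [hrem] at h
        rw [h]
        refine (hiii A z hz).trans ((hii (insert z A) z (Finset.mem_insert_self z A)).trans ?_)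
        have hcard : ((insert z A)ᶜ).card < n := by
          rw [← hn]
          apply Finset.card_lt_card
          rw [Finset.ssubset_iff_of_subset]
          · exact ⟨z, by simpa using hz, by simp⟩
          · intro y; simp
        have hy := fun y => ih _ hcard (insert z A) y rfl
        have h3 : (1 - ∑ y, (K z y).toReal) * R (insert z A) ≤
            (1 - ∑ y, (K z y).toReal) * g (sg (insert z A) η) :=
          mul_le_mul_of_nonneg_left (hR _) (by linarith [kR_sum_le hK z])
        have h4 : ∑ y, (K z y).toReal * W (insert z A) y ≤
            ∑ y, (K z y).toReal * g (addActiveAt (sg (insert z A) η) y) :=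
          Finset.sum_le_sum fun y _ => mul_le_mul_of_nonneg_left (hy y) ENNReal.toReal_nonneg
        linarith
      · have e : addActiveAt (sg A η) z = sg (insert z A) η := by
          funext y
          by_cases hy : y = z
          · subst hy; simp [addActiveAt, sg, hz, hηz, embed, Site.addActive]
          · rw [addActiveAt, Function.update_of_ne hy]; simp [sg, hy]
        rw [e]
        exact (hi A z hz).trans (hR _)
  linarith

theorem exp_conv (θ h : ℝ) (h0 : 0 ≤ h) (h1 : h ≤ 1) :
    Real.exp (-(θ * h)) ≤ 1 - (1 - Real.exp (-θ)) * h := by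
  have := convexOn_exp.2 (Set.mem_univ (-θ)) (Set.mem_univ 0) h0 (sub_nonneg.2 h1) (by ring)
  simp only [smul_eq_mul, Real.exp_zero] at this
  have e : h * -θ + (1 - h) * 0 = -(θ * h) := by ring
  rw [e] at this
  linarith

/-- the main induction -/
theorem main_lower {K : V → V → ℝ≥0∞} (hK : SubStochastic K) (hND : NonDegenerate K)
    (E : ℕ → Conf V → ℝ) (hE : ∀ t, Harm K (E t)) (η : V → Bool) (N : ℝ)
    (hN : N = Fintype.card V) (hN0 : 0 < N)
    (hstep : ∀ t σ, E (t + 1) σ = ∑ x, N⁻¹ * E t (addActiveAt σ x))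
    (hE0 : ∀ σ, 0 ≤ E 0 σ)
    (H : V → V → ℝ) (H0 : ∀ x z, 0 ≤ H x z) (H1 : ∀ x z, H x z ≤ 1)
    (Hs : ∀ x z, z ≠ x → H x z ≤ ∑ y, (K z y).toReal * H x y)
    (θ : ℝ) (hθ : 0 ≤ θ) (t : ℕ) (A : Finset V) :
    E 0 (sg Finset.univ η) * (1 - ∑ x ∈ Aᶜ, Real.exp (θ * (∑ z, H x z - ∑ z ∈ A, H x z)) *
      (1 - (1 - Real.exp (-θ)) * ((∑ z, H x z) / N)) ^ t) ≤ E t (sg A η) := by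
  set β := 1 - Real.exp (-θ) with hβ
  have hβ0 : 0 ≤ β := by
    have : Real.exp (-θ) ≤ 1 := Real.exp_le_one_iff.2 (by linarith)
    linarith
  have hβ1 : β ≤ 1 := by have := Real.exp_pos (-θ); linarith
  have hγ : ∀ x, 0 ≤ 1 - β * ((∑ z, H x z) / N) := by
    intro x
    have h1 : ∑ z, H x z ≤ N := by
      rw [hN]
      calc ∑ z, H x z ≤ ∑ z : V, (1 : ℝ) := Finset.sum_le_sum fun z _ => H1 x z
        _ = _ := by simp
    have h2 : (∑ z, H x z) / N ≤ 1 := (div_le_one hN0).2 h1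
    have h3 : 0 ≤ (∑ z, H x z) / N := div_nonneg (Finset.sum_nonneg fun z _ => H0 x z) hN0.le
    nlinarith
  set μ := E 0 (sg Finset.univ η) with hμ
  have hμ0 : 0 ≤ μ := hE0 _
  induction t generalizing A with
  | zero =>
    by_cases hA : A = Finset.univ
    · subst hA; simp [hμ]
    · have hne : (Aᶜ).Nonempty := by
        rw [Finset.nonempty_iff_ne_empty]; simpa using hA
      obtain ⟨x, hx⟩ := hne
      have hpos : ∀ x ∈ Aᶜ, 0 ≤ Real.exp (θ * (∑ z, H x z - ∑ z ∈ A, H x z)) *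
        (1 - β * ((∑ z, H x z) / N)) ^ 0 := fun x _ => by positivity
      have h1 := Finset.single_le_sum hpos hx
      have h2 : 1 ≤ Real.exp (θ * (∑ z, H x z - ∑ z ∈ A, H x z)) := by
        apply Real.one_le_exp
        apply mul_nonneg hθ
        rw [sub_nonneg]
        exact Finset.sum_le_sum_of_subset_of_nonneg (Finset.subset_univ _) fun z _ _ => H0 x z
      rw [pow_zero, mul_one] at h1
      have h3 : μ * (1 - ∑ x ∈ Aᶜ, Real.exp (θ * (∑ z, H x z - ∑ z ∈ A, H x z)) *
        (1 - β * ((∑ z, H x z) / N)) ^ 0) ≤ 0 :=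
        mul_nonpos_of_nonneg_of_nonpos hμ0 (by linarith)
      exact h3.trans (hE0 _)
  | succ t ih =>
    set c : Finset V → V → ℝ := fun A x => Real.exp (θ * (∑ z, H x z - ∑ z ∈ A, H x z)) *
        (1 - β * ((∑ z, H x z) / N)) ^ t with hc
    have hc0 : ∀ A x, 0 ≤ c A x := fun A x =>
      mul_nonneg (Real.exp_pos _).le (pow_nonneg (hγ x) t)
    have hcB : ∀ A x z, z ∉ A → c (insert z A) x = c A x * Real.exp (-(θ * H x z)) := by
      intro A x z hz
      simp only [hc]
      rw [Finset.sum_insert hz, mul_right_comm, ← Real.exp_add]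
      congr 2; ring
    have hw0 : ∀ x z, 0 ≤ 1 - β * H x z := fun x z => by nlinarith [H0 x z, H1 x z]
    have hsub : ∀ (A : Finset V) (z : V), (insert z A)ᶜ ⊆ Aᶜ := fun A z =>
      Finset.compl_subset_compl.2 (Finset.subset_insert z A)
    have key := step_lower hK hND (E t) (hE t) η
      (fun A => μ * (1 - ∑ x ∈ Aᶜ, c A x))
      (fun A z => μ * (1 - ∑ x ∈ Aᶜ, c A x * (1 - β * H x z)))
      ih ?_ ?_ ?_
    · rw [hstep]
      have h1 : ∑ z, N⁻¹ * (μ * (1 - ∑ x ∈ Aᶜ, c A x * (1 - β * H x z))) ≤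
          ∑ x, N⁻¹ * E t (addActiveAt (sg A η) x) :=
        Finset.sum_le_sum fun z _ => mul_le_mul_of_nonneg_left (key A z) (by positivity)
      refine le_trans (le_of_eq ?_) h1
      rw [← Finset.mul_sum, ← Finset.mul_sum, Finset.sum_sub_distrib, Finset.sum_comm]
      simp only [← Finset.mul_sum, Finset.sum_sub_distrib]
      simp only [Finset.sum_const, Finset.card_univ, nsmul_eq_mul, mul_one, ← hN]
      rw [mul_left_comm, mul_sub N⁻¹, inv_mul_cancel₀ hN0.ne', Finset.mul_sum]
      congr 2
      refine Finset.sum_congr rfl fun x _ => ?_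
      simp only [hc, pow_succ]
      field_simp
    · intro A z hz
      apply mul_le_mul_of_nonneg_left _ hμ0
      have h1 : ∑ x ∈ (insert z A)ᶜ, c (insert z A) x ≤ ∑ x ∈ Aᶜ, c A x * (1 - β * H x z) := by
        calc _ ≤ ∑ x ∈ (insert z A)ᶜ, c A x * (1 - β * H x z) := by
              refine Finset.sum_le_sum fun x _ => ?_
              rw [hcB A x z hz]
              exact mul_le_mul_of_nonneg_left (exp_conv θ _ (H0 x z) (H1 x z)) (hc0 A x)
          _ ≤ _ := Finset.sum_le_sum_of_subset_of_nonneg (hsub A z) fun x _ _ =>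
              mul_nonneg (hc0 A x) (hw0 x z)
      linarith
    · intro A z hz
      have hrhs : ∑ y, (K z y).toReal * (μ * (1 - ∑ x ∈ Aᶜ, c A x * (1 - β * H x y))) +
          (1 - ∑ y, (K z y).toReal) * (μ * (1 - ∑ x ∈ Aᶜ, c A x)) =
          μ * (1 - ∑ x ∈ Aᶜ, c A x * (1 - β * ∑ y, (K z y).toReal * H x y)) := by
        have e1 : ∀ y, (K z y).toReal * (μ * (1 - ∑ x ∈ Aᶜ, c A x * (1 - β * H x y))) =
            (K z y).toReal * (μ * (1 - ∑ x ∈ Aᶜ, c A x)) +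
              ∑ x ∈ Aᶜ, μ * (c A x * β * ((K z y).toReal * H x y)) := by
          intro y
          simp only [mul_sub, mul_one, Finset.sum_sub_distrib, Finset.mul_sum]
          rw [sub_sub_eq_add_sub, add_sub_right_comm]
          congr 1
          exact Finset.sum_congr rfl fun x _ => by ring
        rw [Finset.sum_congr rfl fun y _ => e1 y, Finset.sum_add_distrib, ← Finset.sum_mul,
          Finset.sum_comm]
        have e2 : ∑ x ∈ Aᶜ, ∑ y, μ * (c A x * β * ((K z y).toReal * H x y)) =
            μ * ∑ x ∈ Aᶜ, c A x * (β * ∑ y, (K z y).toReal * H x y) := by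
          rw [Finset.mul_sum]
          refine Finset.sum_congr rfl fun x _ => ?_
          rw [← Finset.mul_sum, ← Finset.mul_sum]; ring
        rw [e2]
        simp only [mul_sub, mul_one, Finset.sum_sub_distrib]
        ring
      rw [hrhs]
      apply mul_le_mul_of_nonneg_left _ hμ0
      apply sub_le_sub_left
      refine Finset.sum_le_sum fun x hx => mul_le_mul_of_nonneg_left ?_ (hc0 A x)
      have hne : z ≠ x := by rintro rfl; exact (Finset.mem_compl.1 hx) hz
      have := mul_le_mul_of_nonneg_left (Hs x z hne) hβ0
      linarith
    · intro A z hz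
      apply mul_le_mul_of_nonneg_left _ hμ0
      apply sub_le_sub_left
      calc _ ≤ ∑ x ∈ (insert z A)ᶜ, c A x * (1 - β * H x z) := by
            refine Finset.sum_le_sum fun x _ => mul_le_mul_of_nonneg_right ?_ (hw0 x z)
            rw [hcB A x z hz]
            refine mul_le_of_le_one_right (hc0 A x) ?_
            rw [Real.exp_le_one_iff]
            have := mul_nonneg hθ (H0 x z); linarith
        _ ≤ _ := Finset.sum_le_sum_of_subset_of_nonneg (hsub A z) fun x _ _ =>
            mul_nonneg (hc0 A x) (hw0 x z)

end Chain
end ARW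

namespace ARW
set_option linter.unusedSectionVars false
set_option linter.unusedSimpArgs false
set_option linter.unusedVariables false

section Core
variable {V : Type} [Fintype V] [DecidableEq V]
variable (K : V → V → ℝ≥0∞)

theorem hI_sum_le (a b : ℝ≥0∞) (hK : SubStochastic K) (hab : a + b = 1) (σ : Conf V) :
    ∑ ξ, hI K a b ξ σ ≤ 1 := by
  have hs : ∑ ζ, hI K a b ζ σ = ⨆ t, ∑ ζ, hT K a b ζ t σ := by
    rw [← ENNReal.finsetSum_iSup_of_monotone]
    · rfl
    · intro ζ; exact hT_mono K a b ζ σ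
  rw [hs]
  refine iSup_le fun t => ?_
  clear hs
  induction t generalizing σ with
  | zero =>
    by_cases h : (activeSites σ).Nonempty
    · have : ∀ ζ, σ ≠ embed ζ := fun ζ e => embed_not_active ζ (e ▸ h)
      simp [hT, this]
    · obtain ⟨ζ, rfl⟩ := not_active_embed σ h
      simp [hT_stable]
  | succ t ih =>
    by_cases h : (activeSites σ).Nonempty
    · simp_rw [fun ζ => hT_act K a b ζ t σ h]
      have := lz_sum K a b h.choose (fun ζ => hT K a b ζ t) (fun _ => 1) σ
      simp only [mul_one] at this
      rw [← this, ← lz_one K a b hK hab h.choose σ]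
      exact lz_mono K a b _ ih σ
    · obtain ⟨ζ, rfl⟩ := not_active_embed σ h
      simp [hT_stable]

theorem hR_nonneg (a b : ℝ≥0∞) (ξ : V → Bool) (σ : Conf V) : 0 ≤ hR K a b ξ σ :=
  ENNReal.toReal_nonneg

theorem hR_stable (a b : ℝ≥0∞) (ξ ζ : V → Bool) :
    hR K a b ξ (embed ζ) = if ζ = ξ then 1 else 0 := by
  rw [hR, hI_stable]; split_ifs <;> simp

theorem hR_sum_le (a b : ℝ≥0∞) (hK : SubStochastic K) (hab : a + b = 1) (σ : Conf V) :
    ∑ ξ, hR K a b ξ σ ≤ 1 := by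
  unfold hR
  rw [← ENNReal.toReal_sum fun ξ _ => hI_ne_top K a b hK hab ξ σ]
  exact ENNReal.toReal_le_of_le_ofReal zero_le_one (by simpa using hI_sum_le K a b hK hab σ)

theorem hR_comp (a b : ℝ≥0∞) (hK : SubStochastic K) (hab : a + b = 1) (ξ : V → Bool) (σ : Conf V)
    (x : V) : ∑ ζ, hR K a b ζ σ * hR K a b ξ (addActiveAt (embed ζ) x) =
      hR K a b ξ (addActiveAt σ x) := by
  have hi := hI_ne_top K a b hK hab
  unfold hR
  rw [← hI_comp, ENNReal.toReal_sum fun ζ _ => ENNReal.mul_ne_top (hi _ _) (hi _ _)]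
  simp only [ENNReal.toReal_mul]

theorem vecpow {S : Type} [Fintype S] [DecidableEq S] (P : Matrix S S ℝ) (π : S → ℝ)
    (h : ∀ s, ∑ r, π r * P r s = π s) (t : ℕ) (s : S) : ∑ r, π r * (P ^ t) r s = π s := by
  have h1 : Matrix.vecMul π P = π := by
    funext s; simpa [Matrix.vecMul, dotProduct] using h s
  have h2 : Matrix.vecMul π (P ^ t) = π := by
    induction t with
    | zero => simp
    | succ t ih => rw [pow_succ, ← Matrix.vecMul_vecMul, ih, h1]
  have := congrFun h2 s
  simpa [Matrix.vecMul, dotProduct] using this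

theorem embed_tcnt_false : tcnt (embed (fun _ : V => false)) = 0 := by
  simp [tcnt, embed, scnt]

theorem embed_tcnt_true : tcnt (embed (fun _ : V => true)) = Fintype.card V := by
  simp [tcnt, embed, scnt]

theorem chain_core [Nonempty V] (hK : SubStochastic K) (hND : NonDegenerate K)
    (lam : ℝ) (hl : 0 < lam) (π : (V → Bool) → ℝ)
    (hπ : IsStationary (arwMatrix K lam (unifLaw V)) π)
    (H : V → V → ℝ) (H0 : ∀ x z, 0 ≤ H x z) (H1 : ∀ x z, H x z ≤ 1)
    (Hs : ∀ x z, z ≠ x → H x z ≤ ∑ y, (K z y).toReal * H x y)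
    (Hp : ∀ x, 0 < ∑ z, H x z) :
    (∀ ξ, 0 < π ξ) ∧
    (∀ θ : ℝ, 0 < θ → ∀ t η ξ, π ξ * (1 - ∑ x, Real.exp (θ * ∑ z, H x z) *
      (1 - (1 - Real.exp (-θ)) * ((∑ z, H x z) / Fintype.card V)) ^ t) ≤
        (arwMatrix K lam (unifLaw V) ^ t) η ξ) ∧
    (∀ t, t < Fintype.card V →
      (arwMatrix K lam (unifLaw V) ^ t) (fun _ => false) (fun _ => true) = 0) ∧
    (∀ t η ξ, 0 ≤ (arwMatrix K lam (unifLaw V) ^ t) η ξ) ∧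
    (∀ t η, ∑ ξ, (arwMatrix K lam (unifLaw V) ^ t) η ξ = 1) := by
  have hab := lam_ab lam hl
  have hb : (1 / (ENNReal.ofReal lam + 1)) ≠ 0 := by simp
  have ha : ENNReal.ofReal lam / (ENNReal.ofReal lam + 1) ≠ 0 := by
    simp [ENNReal.div_eq_zero_iff, hl]
  have hsup := fun ξ η => kp_sup K hK lam hl ξ η
  set a := ENNReal.ofReal lam / (ENNReal.ofReal lam + 1) with ha_def
  set b := 1 / (ENNReal.ofReal lam + 1) with hb_def
  set P := arwMatrix K lam (unifLaw V) with hP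
  set N : ℝ := (Fintype.card V : ℝ) with hN
  have hN0 : 0 < N := by rw [hN]; exact_mod_cast Fintype.card_pos
  have hi := hI_ne_top K a b hK hab
  have P_eq : ∀ η ξ, P η ξ = ∑ x, N⁻¹ * hR K a b ξ (addActiveAt (embed η) x) := by
    intro η ξ
    simp only [hP, arwMatrix, Matrix.of_apply, arwStep, unifLaw]
    simp_rw [hsup]
    rw [ENNReal.toReal_sum]
    · refine Finset.sum_congr rfl fun x _ => ?_
      rw [ENNReal.toReal_mul, ENNReal.toReal_inv]
      simp [hN, hR]
    · intro x _
      refine ENNReal.mul_ne_top ?_ (hi _ _)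
      simp
  have hP0 : ∀ η ξ, 0 ≤ P η ξ := fun η ξ => by
    rw [P_eq]
    exact Finset.sum_nonneg fun x _ => mul_nonneg (by positivity) (hR_nonneg K a b _ _)
  have hPt0 : ∀ t η ξ, 0 ≤ (P ^ t) η ξ := by
    intro t
    induction t with
    | zero => intro η ξ; rw [pow_zero, Matrix.one_apply]; split_ifs <;> norm_num
    | succ t ih =>
      intro η ξ
      rw [pow_succ, Matrix.mul_apply]
      exact Finset.sum_nonneg fun ζ _ => mul_nonneg (ih _ _) (hP0 _ _)
  set E : (V → Bool) → ℕ → Conf V → ℝ := fun ξ t σ => ∑ ζ, hR K a b ζ σ * (P ^ t) ζ ξ with hE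
  have E_harm : ∀ ξ t, Harm K (E ξ t) := fun ξ t =>
    harm_sum K (fun ζ => hR K a b ζ) (fun ζ => (P ^ t) ζ ξ) fun ζ => hR_harm K a b hK hab hb ζ
  have E_step : ∀ ξ t σ, E ξ (t + 1) σ = ∑ x, N⁻¹ * E ξ t (addActiveAt σ x) := by
    intro ξ t σ
    simp only [hE, pow_succ', Matrix.mul_apply]
    simp_rw [P_eq, ← fun ζ x => hR_comp K a b hK hab ζ σ x]
    simp only [Finset.mul_sum, Finset.sum_mul]
    rw [Finset.sum_comm]
    conv_lhs => enter [2, ζ']; rw [Finset.sum_comm]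
    rw [Finset.sum_comm]
    refine Finset.sum_congr rfl fun x _ => Finset.sum_congr rfl fun ζ' _ =>
      Finset.sum_congr rfl fun ζ _ => by ring
  have E_embed : ∀ ξ t η, E ξ t (embed η) = (P ^ t) η ξ := by
    intro ξ t η; simp [hE, hR_stable]
  have E_zero : ∀ ξ σ, E ξ 0 σ = hR K a b ξ σ := by
    intro ξ σ; simp [hE, Matrix.one_apply]
  set μ : (V → Bool) → ℝ := fun ξ => hR K a b ξ (sg Finset.univ (fun _ => false)) with hμ
  have sg_univ : ∀ η : V → Bool, sg Finset.univ η = sg Finset.univ (fun _ => false) := by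
    intro η; funext x; simp [sg]
  have lower : ∀ θ : ℝ, 0 < θ → ∀ t η ξ, μ ξ * (1 - ∑ x, Real.exp (θ * ∑ z, H x z) *
      (1 - (1 - Real.exp (-θ)) * ((∑ z, H x z) / N)) ^ t) ≤ (P ^ t) η ξ := by
    intro θ hθ t η ξ
    have := main_lower hK hND (E ξ) (E_harm ξ) η N hN hN0 (E_step ξ)
      (fun σ => by rw [E_zero]; exact hR_nonneg K a b _ _) H H0 H1 Hs θ hθ.le t ∅
    rw [sg_empty, E_embed, E_zero, sg_univ] at this
    simpa using this
  have μpos : ∀ ξ, 0 < μ ξ := fun ξ => ENNReal.toReal_pos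
    (hI_pos K a b hK hND ha hb ξ _) (hi _ _)
  -- comparison of `π` and `μ`
  have πge : ∀ ξ, μ ξ ≤ π ξ := by
    intro ξ
    have hstat := vecpow P π hπ.2.2
    have hle : ∀ t, μ ξ * (1 - ∑ x, Real.exp (1 * ∑ z, H x z) *
      (1 - (1 - Real.exp (-1)) * ((∑ z, H x z) / N)) ^ t) ≤ π ξ := by
      intro t
      rw [← hstat t ξ]
      calc _ = ∑ r, π r * (μ ξ * (1 - ∑ x, Real.exp (1 * ∑ z, H x z) *
          (1 - (1 - Real.exp (-1)) * ((∑ z, H x z) / N)) ^ t)) := by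
            rw [← Finset.sum_mul, hπ.2.1, one_mul]
        _ ≤ _ := Finset.sum_le_sum fun r _ =>
            mul_le_mul_of_nonneg_left (lower 1 one_pos t r ξ) (hπ.1 r)
    have hlim : Tendsto (fun t : ℕ => μ ξ * (1 - ∑ x, Real.exp (1 * ∑ z, H x z) *
      (1 - (1 - Real.exp (-1)) * ((∑ z, H x z) / N)) ^ t)) atTop (nhds (μ ξ * (1 - ∑ x : V,
        Real.exp (1 * ∑ z, H x z) * 0))) := by
      refine Tendsto.const_mul _ (Tendsto.const_sub _ (tendsto_finsetSum _ fun x _ =>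
        Tendsto.const_mul _ (tendsto_pow_atTop_nhds_zero_of_lt_one ?_ ?_)))
      · have h1 : ∑ z, H x z ≤ N := by
          rw [hN]
          calc ∑ z, H x z ≤ ∑ z : V, (1 : ℝ) := Finset.sum_le_sum fun z _ => H1 x z
            _ = _ := by simp
        have h2 : (∑ z, H x z) / N ≤ 1 := (div_le_one hN0).2 h1
        have h3 : 0 < (∑ z, H x z) / N := div_pos (Hp x) hN0
        have h4 := Real.exp_pos (-1)
        have h5 : Real.exp (-1) ≤ 1 := Real.exp_le_one_iff.2 (by norm_num)
        nlinarith
      · have h3 : 0 < (∑ z, H x z) / N := div_pos (Hp x) hN0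
        have h5 : Real.exp (-1) < 1 := Real.exp_lt_one_iff.2 (by norm_num)
        nlinarith
    have := le_of_tendsto' hlim hle
    simpa using this
  have πpos : ∀ ξ, 0 < π ξ := fun ξ => lt_of_lt_of_le (μpos ξ) (πge ξ)
  have hrow_eq : ∀ η, ∑ ξ, P η ξ = ∑ x, N⁻¹ * ∑ ξ, hR K a b ξ (addActiveAt (embed η) x) := by
    intro η
    simp_rw [P_eq]
    rw [Finset.sum_comm]
    simp only [Finset.mul_sum]
  have hNsum : ∑ x : V, N⁻¹ = 1 := by
    rw [Finset.sum_const, Finset.card_univ, nsmul_eq_mul, ← hN, mul_inv_cancel₀ hN0.ne']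
  have hs1 := hR_sum_le K a b hK hab
  have hrow_le : ∀ η, ∑ ξ, P η ξ ≤ 1 := by
    intro η
    rw [hrow_eq, ← hNsum]
    exact Finset.sum_le_sum fun x _ => mul_le_of_le_one_right (by positivity) (hs1 _)
  have hrow : ∀ η, ∑ ξ, P η ξ = 1 := by
    have h1 : ∑ η, π η * (1 - ∑ ξ, P η ξ) = 0 := by
      simp only [mul_sub, mul_one, Finset.sum_sub_distrib, Finset.mul_sum]
      rw [Finset.sum_comm, hπ.2.1]
      simp_rw [hπ.2.2]
      rw [hπ.2.1, sub_self]
    intro η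
    have h2 := (Finset.sum_eq_zero_iff_of_nonneg (fun η _ =>
      mul_nonneg (hπ.1 η) (sub_nonneg.2 (hrow_le η)))).1 h1 η (Finset.mem_univ η)
    rcases mul_eq_zero.1 h2 with h | h
    · exact absurd h (πpos η).ne'
    · linarith
  have hs_eq : ∀ η x, ∑ ξ, hR K a b ξ (addActiveAt (embed η) x) = 1 := by
    intro η x
    have h1 : ∑ x, N⁻¹ * (1 - ∑ ξ, hR K a b ξ (addActiveAt (embed η) x)) = 0 := by
      simp only [mul_sub, mul_one, Finset.sum_sub_distrib]
      rw [← hrow_eq, hrow, hNsum, sub_self]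
    have h2 := (Finset.sum_eq_zero_iff_of_nonneg (fun x _ =>
      mul_nonneg (by positivity) (sub_nonneg.2 (hs1 (addActiveAt (embed η) x))))).1 h1 x
        (Finset.mem_univ x)
    rcases mul_eq_zero.1 h2 with h | h
    · exact absurd h (by positivity)
    · linarith
  have hs_add : ∀ σ x, ∑ ξ, hR K a b ξ (addActiveAt σ x) = ∑ ξ, hR K a b ξ σ := by
    intro σ x
    simp_rw [← fun ζ => hR_comp K a b hK hab ζ σ x]
    rw [Finset.sum_comm]
    refine Finset.sum_congr rfl fun ζ _ => ?_
    rw [← Finset.mul_sum, hs_eq, mul_one]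
  have hs_sg : ∀ A : Finset V, ∑ ξ, hR K a b ξ (sg A (fun _ => false)) = 1 := by
    intro A
    induction A using Finset.induction_on with
    | empty => rw [sg_empty]; simp [hR_stable]
    | insert x A hx ih =>
      have e : sg (insert x A) (fun _ => false) = addActiveAt (sg A (fun _ => false)) x := by
        funext y
        by_cases hy : y = x
        · subst hy; simp [sg, addActiveAt, hx, embed, Site.addActive]
        · rw [addActiveAt, Function.update_of_ne hy]; simp [sg, hy]
      rw [e, hs_add, ih]
  have hμπ : ∀ ξ, μ ξ = π ξ := by
    have h1 : ∑ ξ, (π ξ - μ ξ) = 0 := by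
      rw [Finset.sum_sub_distrib, hπ.2.1, hs_sg, sub_self]
    intro ξ
    have := (Finset.sum_eq_zero_iff_of_nonneg (fun ξ _ => sub_nonneg.2 (πge ξ))).1 h1 ξ
      (Finset.mem_univ ξ)
    linarith
  refine ⟨πpos, ?_, ?_, hPt0, ?_⟩
  · intro θ hθ t η ξ
    rw [← hμπ]; exact lower θ hθ t η ξ
  · have hcnt : ∀ t ξ, ∀ σ : Conf V, tcnt σ + t < tcnt (embed ξ) → E ξ t σ = 0 := by
      intro t ξ
      induction t with
      | zero =>
        intro σ h
        rw [E_zero, hR, hI_cnt K a b ξ σ (by omega)]; rfl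
      | succ t ih =>
        intro σ h
        rw [E_step]
        refine Finset.sum_eq_zero fun x _ => ?_
        rw [ih _ (by rw [tcnt_add]; omega), mul_zero]
    intro t ht
    rw [← E_embed]
    apply hcnt
    rw [embed_tcnt_false, embed_tcnt_true]; omega
  · intro t
    induction t with
    | zero => intro η; simp [Matrix.one_apply]
    | succ t ih =>
      intro η
      simp only [pow_succ, Matrix.mul_apply]
      rw [Finset.sum_comm]
      simp_rw [← Finset.mul_sum, hrow, mul_one, ih]

end Core
end ARW

namespace ARW
set_option linter.unusedSectionVars false
set_option linter.unusedSimpArgs false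
set_option linter.unusedVariables false

section Sep
variable {S : Type} [Fintype S] [DecidableEq S]

theorem sep_le [Nonempty S] (P : Matrix S S ℝ) (π : S → ℝ) (hπ : ∀ s, 0 < π s) (t : ℕ) (e : ℝ)
    (h : ∀ η ξ, π ξ * (1 - e) ≤ (P ^ t) η ξ) : sepDist P π t ≤ e := by
  refine ciSup_le fun η => ciSup_le fun ξ => ?_
  have h1 : 1 - e ≤ (P ^ t) η ξ / π ξ := by
    rw [le_div_iff₀ (hπ ξ)]; linarith [h η ξ]
  linarith

theorem le_sep (P : Matrix S S ℝ) (π : S → ℝ) (t : ℕ) (η ξ : S) :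
    1 - (P ^ t) η ξ / π ξ ≤ sepDist P π t := by
  refine le_trans ?_ (le_ciSup (Set.finite_range _).bddAbove η)
  exact le_ciSup (f := fun ξ => 1 - (P ^ t) η ξ / π ξ) (Set.finite_range _).bddAbove ξ

theorem sep_nonneg [Nonempty S] (P : Matrix S S ℝ) (π : S → ℝ) (hπ : ∀ s, 0 < π s) (t : ℕ)
    (h1 : ∑ s, π s = 1) (h2 : ∀ η, ∑ ξ, (P ^ t) η ξ = 1) : 0 ≤ sepDist P π t := by
  by_contra hc
  push Not at hc
  obtain ⟨η⟩ := ‹Nonempty S›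
  have h3 : ∑ ξ, π ξ < ∑ ξ, (P ^ t) η ξ := by
    refine Finset.sum_lt_sum_of_nonempty ⟨η, Finset.mem_univ _⟩ fun ξ _ => ?_
    have := le_sep P π t η ξ
    have h4 : 1 < (P ^ t) η ξ / π ξ := by linarith
    rwa [one_lt_div (hπ ξ)] at h4
  rw [h1, h2] at h3
  exact lt_irrefl _ h3

theorem sep_one [Nonempty S] (P : Matrix S S ℝ) (π : S → ℝ) (hπ : ∀ s, 0 < π s) (t : ℕ)
    (h0 : ∀ η ξ, 0 ≤ (P ^ t) η ξ) (η ξ : S) (h : (P ^ t) η ξ = 0) : sepDist P π t = 1 := by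
  apply le_antisymm
  · apply sep_le P π hπ
    intro η ξ; simpa using h0 η ξ
  · have := le_sep P π t η ξ
    simpa [h] using this

theorem eig_bound (P : Matrix S S ℝ) (π : S → ℝ) (h1 : ∑ s, π s = 1)
    (hst : ∀ s, ∑ r, π r * P r s = π s)
    (h2 : ∀ t η, ∑ ξ, (P ^ t) η ξ = 1) (C q : ℝ) (hq : 0 < q)
    (h : ∀ t η ξ, π ξ * (1 - C * q ^ t) ≤ (P ^ t) η ξ)
    (z : ℂ) (hz : z ≠ 1) (hr : (P.map (fun a : ℝ => (a : ℂ))).charpoly.IsRoot z) : ‖z‖ ≤ q := by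
  set M : Matrix S S ℂ := P.map (fun a : ℝ => (a : ℂ)) with hM
  have hMt : ∀ t η ξ, (M ^ t) η ξ = (((P ^ t) η ξ : ℝ) : ℂ) := by
    intro t
    have : M = (Complex.ofRealHom.mapMatrix P) := rfl
    rw [this, ← map_pow]
    intro η ξ; rfl
  rw [Polynomial.IsRoot, Matrix.eval_charpoly] at hr
  obtain ⟨v, hv, hv'⟩ := Matrix.exists_mulVec_eq_zero_iff.2 hr
  have hMv : M.mulVec v = z • v := by
    rw [Matrix.sub_mulVec, Matrix.scalar_apply] at hv'
    have : (Matrix.diagonal fun _ => z).mulVec v = z • v := by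
      funext i; simp [Matrix.mulVec_diagonal]
    rw [this] at hv'
    exact (sub_eq_zero.1 hv').symm
  have hMtv : ∀ t, (M ^ t).mulVec v = z ^ t • v := by
    intro t
    induction t with
    | zero => simp
    | succ t ih => rw [pow_succ, ← Matrix.mulVec_mulVec, hMv, Matrix.mulVec_smul, ih, smul_smul,
        pow_succ, mul_comm]
  have hpi : ∑ r, (π r : ℂ) * v r = 0 := by
    have e1 : ∑ r, (π r : ℂ) * (M.mulVec v) r = ∑ s, (π s : ℂ) * v s := by
      simp only [Matrix.mulVec, dotProduct, Finset.mul_sum]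
      rw [Finset.sum_comm]
      refine Finset.sum_congr rfl fun s _ => ?_
      rw [← hst s]
      push_cast
      rw [Finset.sum_mul]
      refine Finset.sum_congr rfl fun r _ => ?_
      simp [hM]; ring
    rw [hMv] at e1
    have e2 : z * ∑ r, (π r : ℂ) * v r = ∑ s, (π s : ℂ) * v s := by
      refine Eq.trans ?_ e1
      rw [Finset.mul_sum]
      refine Finset.sum_congr rfl fun s _ => ?_
      simp; ring
    have e3 : (z - 1) * ∑ r, (π r : ℂ) * v r = 0 := by rw [sub_mul, e2]; ring
    rcases mul_eq_zero.1 e3 with h | h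
    · exact absurd (sub_eq_zero.1 h) hz
    · exact h
  obtain ⟨i, hi⟩ : ∃ i, v i ≠ 0 := by
    by_contra hc; push Not at hc; exact hv (funext hc)
  obtain ⟨η, -, hη⟩ := Finset.exists_max_image Finset.univ (fun s => ‖v s‖) ⟨i, Finset.mem_univ i⟩
  have hpos : 0 < ‖v η‖ := lt_of_lt_of_le (norm_pos_iff.2 hi) (hη i (Finset.mem_univ i))
  have key : ∀ t, ‖z‖ ^ t ≤ C * q ^ t := by
    intro t
    have e1 : z ^ t * v η = ∑ ξ, (((P ^ t) η ξ - π ξ * (1 - C * q ^ t) : ℝ) : ℂ) * v ξ := by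
      have e2 := congrFun (hMtv t) η
      simp only [Matrix.mulVec, dotProduct, Pi.smul_apply, smul_eq_mul, hMt] at e2
      rw [← e2]
      push_cast
      simp only [sub_mul, Finset.sum_sub_distrib]
      have : ∑ x, (π x : ℂ) * (1 - (C : ℂ) * (q : ℂ) ^ t) * v x = 0 := by
        rw [← mul_zero (1 - (C : ℂ) * (q : ℂ) ^ t), ← hpi, Finset.mul_sum]
        exact Finset.sum_congr rfl fun x _ => by ring
      rw [this, sub_zero]
    have e3 : ‖z‖ ^ t * ‖v η‖ ≤ (C * q ^ t) * ‖v η‖ := by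
      rw [← norm_pow, ← norm_mul, e1]
      calc _ ≤ ∑ ξ, ((P ^ t) η ξ - π ξ * (1 - C * q ^ t)) * ‖v η‖ := by
            refine (norm_sum_le _ _).trans (Finset.sum_le_sum fun ξ _ => ?_)
            have := h t η ξ
            rw [norm_mul, Complex.norm_real, Real.norm_of_nonneg (by linarith)]
            exact mul_le_mul_of_nonneg_left (hη ξ (Finset.mem_univ ξ)) (by linarith)
        _ = _ := by
            rw [← Finset.sum_mul, Finset.sum_sub_distrib, h2, ← Finset.sum_mul, h1]; ring
    exact le_of_mul_le_mul_right e3 hpos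
  by_contra hc
  push Not at hc
  have h5 : 1 < ‖z‖ / q := by rwa [one_lt_div hq]
  have h6 := tendsto_pow_atTop_atTop_of_one_lt h5
  obtain ⟨t, ht⟩ := (h6.eventually_gt_atTop C).exists
  have := key t
  rw [div_pow, lt_div_iff₀ (by positivity)] at ht
  linarith

theorem rel_bound (P : Matrix S S ℝ) (q : ℝ) (hq : 0 ≤ q) (hq1 : q < 1)
    (h : ∀ z : ℂ, z ≠ 1 → (P.map (fun a : ℝ => (a : ℂ))).charpoly.IsRoot z → ‖z‖ ≤ q) :
    0 ≤ relTime P ∧ relTime P ≤ (1 - q)⁻¹ := by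
  unfold relTime
  have h1 : sSup {r : ℝ | ∃ z : ℂ,
      z ≠ 1 ∧ (P.map (fun a : ℝ => (a : ℂ))).charpoly.IsRoot z ∧ r = ‖z‖} ≤ q := by
    apply Real.sSup_le _ hq
    rintro r ⟨z, hz, hr, rfl⟩
    exact h z hz hr
  refine ⟨inv_nonneg.2 (by linarith), ?_⟩
  apply inv_anti₀ <;> linarith

end Sep

section Core2
variable {V : Type} [Fintype V] [DecidableEq V]

theorem sep_core [Nonempty V] (K : V → V → ℝ≥0∞) (hK : SubStochastic K) (hND : NonDegenerate K)
    (lam : ℝ) (hl : 0 < lam) (π : (V → Bool) → ℝ)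
    (hπ : IsStationary (arwMatrix K lam (unifLaw V)) π)
    (H : V → V → ℝ) (H0 : ∀ x z, 0 ≤ H x z) (H1 : ∀ x z, H x z ≤ 1)
    (Hs : ∀ x z, z ≠ x → H x z ≤ ∑ y, (K z y).toReal * H x y)
    (s : ℝ) (hs : 0 < s) (Hp : ∀ x, s ≤ ∑ z, H x z) :
    (∀ t, 0 ≤ sepDist (arwMatrix K lam (unifLaw V)) π t) ∧
    (∀ t, t < Fintype.card V → sepDist (arwMatrix K lam (unifLaw V)) π t = 1) ∧
    (∀ δ : ℝ, 0 < δ → ∀ t : ℕ, (1 + δ) * Fintype.card V ≤ t →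
      sepDist (arwMatrix K lam (unifLaw V)) π t ≤
        Fintype.card V * Real.exp (-(δ ^ 2 / (4 + 2 * δ) * s))) ∧
    0 ≤ relTime (arwMatrix K lam (unifLaw V)) ∧
    relTime (arwMatrix K lam (unifLaw V)) ≤
      (1 - Real.exp (-1))⁻¹ * (Fintype.card V / s) := by
  obtain ⟨c1, c2, c3, c4, c5⟩ := chain_core K hK hND lam hl π hπ H H0 H1 Hs
    (fun x => lt_of_lt_of_le hs (Hp x))
  set P := arwMatrix K lam (unifLaw V)
  have hN0 : (0 : ℝ) < Fintype.card V := by exact_mod_cast Fintype.card_pos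
  have hSN : ∀ x, ∑ z, H x z ≤ Fintype.card V := fun x => by
    calc ∑ z, H x z ≤ ∑ z : V, (1 : ℝ) := Finset.sum_le_sum fun z _ => H1 x z
      _ = _ := by simp
  set N : ℝ := (Fintype.card V : ℝ) with hN
  have hsN : s ≤ N := (Hp (Classical.arbitrary V)).trans (hSN _)
  refine ⟨fun t => sep_nonneg P π c1 t hπ.2.1 (c5 t), fun t ht => sep_one P π c1 t (c4 t) _ _ (c3 t ht),
    ?_, ?_⟩
  · intro δ hδ t ht
    refine (sep_le P π c1 t _ fun η ξ => c2 (δ / 2) (by positivity) t η ξ).trans ?_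
    rw [show N * Real.exp (-(δ ^ 2 / (4 + 2 * δ) * s)) =
      ∑ x : V, Real.exp (-(δ ^ 2 / (4 + 2 * δ) * s)) by simp [hN]]
    refine Finset.sum_le_sum fun x _ => ?_
    set σ := ∑ z, H x z with hσ
    have hσs := Hp x
    have hσN := hSN x
    set w := 1 - Real.exp (-(δ / 2)) with hw
    have hw1 : w ≤ 1 := by have := Real.exp_pos (-(δ / 2)); linarith
    have hw2 : δ / (2 + δ) ≤ w := by
      have e1 := Real.add_one_le_exp (δ / 2)
      have e2 : Real.exp (-(δ / 2)) ≤ (δ / 2 + 1)⁻¹ := by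
        rw [Real.exp_neg]; exact inv_anti₀ (by positivity) e1
      have e3 : (δ / 2 + 1)⁻¹ = 1 - δ / (2 + δ) := by field_simp; ring
      linarith
    have hw0 : 0 < w := lt_of_lt_of_le (by positivity) hw2
    have hσ0 : 0 < σ := lt_of_lt_of_le hs hσs
    have hu : σ / N ≤ 1 := (div_le_one hN0).2 hσN
    have hu0 : 0 < σ / N := by positivity
    have b0 : 0 ≤ 1 - w * (σ / N) := by nlinarith
    have b1 : (1 - w * (σ / N)) ^ t ≤ Real.exp (-(w * (σ / N)) * t) := by
      rw [mul_comm _ (t : ℝ), Real.exp_nat_mul]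
      exact pow_le_pow_left₀ b0 (by linarith [Real.add_one_le_exp (-(w * (σ / N)))]) t
    refine (mul_le_mul_of_nonneg_left b1 (Real.exp_pos _).le).trans ?_
    rw [← Real.exp_add]
    apply Real.exp_le_exp.2
    have b2 : w * (1 + δ) * σ ≤ w * (σ / N) * t := by
      calc w * (1 + δ) * σ = w * (σ / N) * ((1 + δ) * N) := by field_simp
        _ ≤ _ := mul_le_mul_of_nonneg_left ht (by positivity)
    have b3 : δ / (2 + δ) * (1 + δ) * σ ≤ w * (1 + δ) * σ := by gcongr
    have b4 : δ / (2 + δ) * (1 + δ) = δ / 2 + δ ^ 2 / (4 + 2 * δ) := by field_simp; ring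
    have b5 : δ ^ 2 / (4 + 2 * δ) * s ≤ δ ^ 2 / (4 + 2 * δ) * σ := by gcongr
    rw [b4] at b3
    nlinarith
  · have he : Real.exp (-1) < 1 := Real.exp_lt_one_iff.2 (by norm_num)
    have he0 := Real.exp_pos (-1)
    have hu : s / N ≤ 1 := (div_le_one hN0).2 hsN
    have hu0 : 0 < s / N := by positivity
    set q := 1 - (1 - Real.exp (-1)) * (s / N) with hq
    have hq0 : 0 < q := by nlinarith
    have hq1 : q < 1 := by nlinarith
    have := rel_bound P q hq0.le hq1 (eig_bound P π hπ.2.1 hπ.2.2 c5 (∑ x, Real.exp (1 * ∑ z, H x z)) q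
      hq0 ?_)
    · refine ⟨this.1, this.2.trans (le_of_eq ?_)⟩
      rw [hq, sub_sub_cancel, mul_inv, inv_div]
    · intro t η ξ
      refine le_trans ?_ (c2 1 one_pos t η ξ)
      refine mul_le_mul_of_nonneg_left ?_ (c1 ξ).le
      rw [Finset.sum_mul]
      refine sub_le_sub_left (Finset.sum_le_sum fun x _ => ?_) _
      refine mul_le_mul_of_nonneg_left (pow_le_pow_left₀ ?_ ?_ t) (Real.exp_pos _).le
      · have h2 : (∑ z, H x z) / N ≤ 1 := (div_le_one hN0).2 (hSN x)
        have h3 : 0 < (∑ z, H x z) / N := div_pos (lt_of_lt_of_le hs (Hp x)) hN0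
        nlinarith
      · have h3 : s / N ≤ (∑ z, H x z) / N := by gcongr; exact Hp x
        rw [hq]
        nlinarith

end Core2
end ARW

namespace ARW
set_option linter.unusedSectionVars false
set_option linter.unusedSimpArgs false
set_option linter.unusedVariables false

section Green
variable {V : Type} [Fintype V] [DecidableEq V]

theorem green [Nonempty V] (K : V → V → ℝ≥0∞) (hK : SubStochastic K) (hND : NonDegenerate K)
    (hsym : ∀ x y, K x y = K y x) :
    ∃ H : V → V → ℝ, (∀ x z, 0 ≤ H x z) ∧ (∀ x z, H x z ≤ 1) ∧
      (∀ x z, z ≠ x → H x z ≤ ∑ y, (K z y).toReal * H x y) ∧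
      (∀ x, 1 ≤ ∑ z, H x z) ∧
      (∀ x (u f : V → ℝ), (∀ z, u z - ∑ y, (K z y).toReal * u y ≤ 1) →
        (∀ z, (if z = x then 1 else 0) ≤ f z - ∑ y, (K z y).toReal * f y) →
        u x ≤ f x * ∑ z, H x z ∧ ∑ y, (K x y).toReal * u y ≤ f x * ∑ z, H x z) := by
  set k : Matrix V V ℝ := Matrix.of fun x y => (K x y).toReal with hk
  have hk0 : ∀ x y, 0 ≤ (K x y).toReal := fun _ _ => ENNReal.toReal_nonneg
  have mp : ∀ D : V → ℝ, (∀ z, ∑ y, (K z y).toReal * D y ≤ D z) → ∀ z, 0 ≤ D z := fun D h z =>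
    min_principle hK hND Finset.univ D (fun z _ => h z) (fun z hz => absurd (Finset.mem_univ z) hz) z
  have hmv : ∀ (v : V → ℝ) z, ((1 - k).mulVec v) z = v z - ∑ y, (K z y).toReal * v y := by
    intro v z
    rw [Matrix.sub_mulVec, Matrix.one_mulVec]
    simp [Matrix.mulVec, dotProduct, hk]
  have hdet : IsUnit (1 - k).det := by
    rw [isUnit_iff_ne_zero]
    intro h0
    obtain ⟨v, hv, hv'⟩ := Matrix.exists_mulVec_eq_zero_iff.2 h0
    apply hv
    have h1 : ∀ z, v z - ∑ y, (K z y).toReal * v y = 0 := fun z => by rw [← hmv, hv']; rfl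
    funext z
    have a1 := mp v (fun z => by linarith [h1 z]) z
    have a2 := mp (fun z => - v z) (fun z => by
      simp only [mul_neg, Finset.sum_neg_distrib]; linarith [h1 z]) z
    show v z = 0
    linarith
  set G := (1 - k)⁻¹ with hG
  have hG1 : (1 - k) * G = 1 := Matrix.mul_nonsing_inv _ hdet
  have hksym : k.transpose = k := by
    ext x y; simp [hk, Matrix.transpose_apply, hsym x y]
  have hGsym : ∀ x y, G x y = G y x := by
    intro x y
    have : G.transpose = G := by
      rw [hG, Matrix.transpose_nonsing_inv, Matrix.transpose_sub, hksym, Matrix.transpose_one]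
    exact congrFun (congrFun this y) x
  have hcol : ∀ x z, G z x - ∑ y, (K z y).toReal * G y x = if z = x then 1 else 0 := by
    intro x z
    have := hmv (fun y => G y x) z
    rw [← this]
    have h2 := congrFun (congrFun hG1 z) x
    rw [Matrix.one_apply] at h2
    rw [← h2]; rfl
  have hG0 : ∀ x z, 0 ≤ G z x := by
    intro x
    apply mp (fun z => G z x)
    intro z
    have := hcol x z
    split_ifs at this <;> linarith
  have hGx : ∀ x, 1 ≤ G x x := by
    intro x
    have := hcol x x
    rw [if_pos rfl] at this
    have h2 : 0 ≤ ∑ y, (K x y).toReal * G y x :=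
      Finset.sum_nonneg fun y _ => mul_nonneg (hk0 _ _) (hG0 _ _)
    linarith
  have hGpos : ∀ x, 0 < G x x := fun x => lt_of_lt_of_le one_pos (hGx x)
  have hle : ∀ x z, G z x ≤ G x x := by
    intro x z
    have := min_principle hK hND (Finset.univ.filter (· ≠ x)) (fun z => G x x - G z x) ?_ ?_ z
    · simpa using this
    · intro z hz
      have hz' : z ≠ x := by simpa using hz
      have h1 := hcol x z
      rw [if_neg hz'] at h1
      simp only [mul_sub, Finset.sum_sub_distrib]
      rw [← Finset.sum_mul]
      have h2 := kR_sum_le hK z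
      nlinarith [hGpos x]
    · intro z hz
      have hz' : z = x := by simpa using hz
      simp [hz']
  have hH0 : ∀ x z, 0 ≤ G z x / G x x := fun x z => div_nonneg (hG0 _ _) (hGpos x).le
  refine ⟨fun x z => G z x / G x x, hH0,
    fun x z => (div_le_one (hGpos x)).2 (hle x z), ?_, ?_, ?_⟩
  · intro x z hz
    have h1 := hcol x z
    rw [if_neg hz] at h1
    have : ∑ y, (K z y).toReal * (G y x / G x x) = (∑ y, (K z y).toReal * G y x) / G x x := by
      rw [Finset.sum_div]; exact Finset.sum_congr rfl fun y _ => by ring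
    show G z x / G x x ≤ _
    rw [this]
    exact div_le_div_of_nonneg_right (by linarith) (hGpos x).le
  · intro x
    have := Finset.single_le_sum (f := fun z => G z x / G x x) (fun z _ => hH0 x z) (Finset.mem_univ x)
    simpa [(hGpos x).ne'] using this
  · intro x u f hu hf
    set E : V → ℝ := fun z => ∑ y, G z y with hE
    have hEe : ∀ z, E z - ∑ y, (K z y).toReal * E y = 1 := by
      intro z
      simp only [hE, Finset.mul_sum]
      rw [Finset.sum_comm, ← Finset.sum_sub_distrib]
      simp_rw [hcol]
      simp
    have hEu : ∀ z, u z ≤ E z := by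
      intro z
      have := mp (fun z => E z - u z) (fun z => by
        simp only [mul_sub, Finset.sum_sub_distrib]; linarith [hEe z, hu z]) z
      simpa using this
    have hGf : G x x ≤ f x := by
      have := mp (fun z => f z - G z x) (fun z => by
        simp only [mul_sub, Finset.sum_sub_distrib]; linarith [hcol x z, hf z]) x
      simpa using this
    have hS : E x = G x x * ∑ z, G z x / G x x := by
      rw [← Finset.sum_div, mul_div_cancel₀ _ (hGpos x).ne']
      exact Finset.sum_congr rfl fun z _ => hGsym x z
    have hS2 : E x ≤ f x * ∑ z, G z x / G x x := by
      rw [hS]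
      exact mul_le_mul_of_nonneg_right hGf (Finset.sum_nonneg fun z _ => hH0 x z)
    refine ⟨(hEu x).trans hS2, le_trans ?_ hS2⟩
    have h3 : ∑ y, (K x y).toReal * u y ≤ ∑ y, (K x y).toReal * E y :=
      Finset.sum_le_sum fun y _ => mul_le_mul_of_nonneg_left (hEu y) (hk0 _ _)
    linarith [hEe x]

end Green

section Lattice

def sgn (b : Bool) : ℤ := if b then 1 else -1

def nb {d : ℕ} (x : Fin d → ℤ) (p : Fin d × Bool) : Fin d → ℤ :=
  Function.update x p.1 (x p.1 + sgn p.2)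

theorem nb_inj {d : ℕ} (x : Fin d → ℤ) : Function.Injective (nb x) := by
  rintro ⟨i, b⟩ ⟨j, c⟩ h
  have h1 := congrFun h i
  by_cases hij : i = j
  · subst hij
    simp only [nb, Function.update_self] at h1
    cases b <;> cases c <;> simp [sgn] at h1 ⊢
  · simp only [nb, Function.update_self, Function.update_of_ne hij] at h1
    cases b <;> simp [sgn] at h1

theorem sum_nb {d : ℕ} (x : Fin d → ℤ) (p : Fin d × Bool) (g : Fin d → ℤ → ℤ) :
    ∑ j, g j (nb x p j) = ∑ j, g j (x j) - g p.1 (x p.1) + g p.1 (x p.1 + sgn p.2) := by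
  rw [← Finset.add_sum_erase _ _ (Finset.mem_univ p.1),
    ← Finset.add_sum_erase Finset.univ (fun j => g j (x j)) (Finset.mem_univ p.1)]
  have : ∑ j ∈ Finset.univ.erase p.1, g j (nb x p j) = ∑ j ∈ Finset.univ.erase p.1, g j (x j) := by
    refine Finset.sum_congr rfl fun j hj => ?_
    rw [nb, Function.update_of_ne (Finset.ne_of_mem_erase hj)]
  rw [this]
  simp only [nb, Function.update_self]
  ring

theorem dist_nb {d : ℕ} (x : Fin d → ℤ) (p : Fin d × Bool) : ∑ i, |x i - nb x p i| = 1 := by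
  rw [sum_nb x p (fun j w => |x j - w|)]
  rcases p with ⟨i, b⟩
  cases b <;> simp [sgn]

theorem exists_nb {d : ℕ} (x y : Fin d → ℤ) (h : ∑ i, |x i - y i| = 1) : ∃ p, y = nb x p := by
  obtain ⟨i, hi⟩ : ∃ i, x i - y i ≠ 0 := by
    by_contra hc
    push Not at hc
    simp [hc] at h
  rw [← Finset.add_sum_erase _ _ (Finset.mem_univ i)] at h
  have h0 : 0 ≤ ∑ j ∈ Finset.univ.erase i, |x j - y j| := Finset.sum_nonneg fun j _ => abs_nonneg _
  have h1 : 0 < |x i - y i| := abs_pos.2 hi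
  have h2 : ∑ j ∈ Finset.univ.erase i, |x j - y j| = 0 := by omega
  have h3 : |x i - y i| = 1 := by omega
  have h4 : ∀ j, j ≠ i → y j = x j := by
    intro j hj
    have := (Finset.sum_eq_zero_iff_of_nonneg (fun j _ => abs_nonneg (x j - y j))).1 h2 j
      (Finset.mem_erase.2 ⟨hj, Finset.mem_univ j⟩)
    have := abs_eq_zero.1 this
    omega
  rcases (abs_eq one_pos.le).1 h3 with h5 | h5
  · refine ⟨(i, false), funext fun j => ?_⟩
    by_cases hj : j = i
    · subst hj; simp [nb, sgn]; omega
    · simp [nb, Function.update_of_ne hj, h4 j hj]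
  · refine ⟨(i, true), funext fun j => ?_⟩
    by_cases hj : j = i
    · subst hj; simp [nb, sgn]; omega
    · simp [nb, Function.update_of_ne hj, h4 j hj]

theorem ind_nb {d : ℕ} {M : Type*} [AddCommMonoid M] (x y : Fin d → ℤ) (c : M) :
    (if (∑ i, |x i - y i|) = 1 then c else 0) = ∑ p, if y = nb x p then c else 0 := by
  by_cases h : ∑ i, |x i - y i| = 1
  · obtain ⟨p, rfl⟩ := exists_nb x y h
    rw [if_pos h, Finset.sum_eq_single p]
    · simp
    · intro q _ hq
      rw [if_neg fun e => hq (nb_inj x e).symm]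
    · simp
  · rw [if_neg h]
    refine (Finset.sum_eq_zero fun p _ => ?_).symm
    rw [if_neg]
    rintro rfl
    exact h (dist_nb x p)

theorem card_p (d : ℕ) (hd : 1 ≤ d) : ∑ p : Fin d × Bool, ((2 * d : ℕ) : ℝ≥0∞)⁻¹ = 1 := by
  rw [Finset.sum_const, Finset.card_univ, nsmul_eq_mul]
  have : Fintype.card (Fin d × Bool) = 2 * d := by simp [mul_comm]
  rw [this, ENNReal.mul_inv_cancel]
  · simp; omega
  · exact ENNReal.natCast_ne_top _

theorem ind_sum_le {d n : ℕ} (S : Finset (LatticeBall d n)) (w : Fin d → ℤ) (c : ℝ≥0∞) :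
    (∑ y ∈ S, if y.1 = w then c else 0) ≤ c := by
  by_cases h : ∃ y ∈ S, y.1 = w
  · obtain ⟨y, hy, rfl⟩ := h
    rw [Finset.sum_eq_single y]
    · simp
    · intro z _ hz
      rw [if_neg fun e => hz (Subtype.ext e)]
    · intro h; exact absurd hy h
  · push Not at h
    rw [Finset.sum_eq_zero fun y hy => if_neg (h y hy)]
    exact zero_le

theorem lat_sub (d n : ℕ) (hd : 1 ≤ d) : SubStochastic (latticeKernel d n) := by
  intro x
  unfold latticeKernel
  simp_rw [ind_nb]
  rw [Finset.sum_comm, ← card_p d hd]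
  exact Finset.sum_le_sum fun p _ => ind_sum_le _ _ _

theorem lat_nd (d n : ℕ) (hd : 1 ≤ d) : NonDegenerate (latticeKernel d n) := by
  intro S hS
  set i0 : Fin d := ⟨0, hd⟩
  obtain ⟨x, hx, hmax⟩ := Finset.exists_max_image S (fun y => y.1 i0) hS
  refine ⟨x, hx, fun h => ?_⟩
  unfold latticeKernel at h
  simp_rw [ind_nb] at h
  rw [Finset.sum_comm, ← Finset.add_sum_erase _ _ (Finset.mem_univ (i0, true))] at h
  have h0 : (∑ y ∈ S, if y.1 = nb x.1 (i0, true) then ((2 * d : ℕ) : ℝ≥0∞)⁻¹ else 0) = 0 := by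
    refine Finset.sum_eq_zero fun y hy => if_neg fun e => ?_
    have h1 := hmax y hy
    rw [e] at h1
    simp [nb, sgn] at h1
  rw [h0, zero_add] at h
  have h2 : (1 : ℝ≥0∞) ≤ ∑ p ∈ Finset.univ.erase (i0, true), ((2 * d : ℕ) : ℝ≥0∞)⁻¹ := by
    rw [← h]
    exact Finset.sum_le_sum fun p _ => ind_sum_le _ _ _
  have h3 := card_p d hd
  rw [← Finset.add_sum_erase _ _ (Finset.mem_univ (i0, true))] at h3
  have h4 : ((2 * d : ℕ) : ℝ≥0∞)⁻¹ + 1 ≤ 1 := by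
    rw [← h3] 
    exact add_le_add_right (h2.trans' h3.le) _
  have h5 : ((2 * d : ℕ) : ℝ≥0∞)⁻¹ ≠ 0 := ENNReal.inv_ne_zero.2 (ENNReal.natCast_ne_top _)
  rw [add_comm] at h4
  exact absurd h4 (not_le.2 (ENNReal.lt_add_right ENNReal.one_ne_top h5))

theorem lat_sym (d n : ℕ) (x y : LatticeBall d n) : latticeKernel d n x y = latticeKernel d n y x := by
  unfold latticeKernel
  simp_rw [abs_sub_comm]

theorem lat_real (d n : ℕ) (x y : LatticeBall d n) : (latticeKernel d n x y).toReal =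
    ∑ p, if y.1 = nb x.1 p then ((2 * d : ℝ))⁻¹ else 0 := by
  rw [← ind_nb, latticeKernel]
  split_ifs <;> simp

theorem lat_sum (d n : ℕ) (x : LatticeBall d n) (F : (Fin d → ℤ) → ℝ) :
    ∑ y, (latticeKernel d n x y).toReal * F y.1 =
      (2 * d : ℝ)⁻¹ * ∑ p, if ∑ i, (nb x.1 p i) ^ 2 ≤ (n : ℤ) then F (nb x.1 p) else 0 := by
  simp_rw [lat_real, Finset.sum_mul]
  rw [Finset.sum_comm, Finset.mul_sum]
  refine Finset.sum_congr rfl fun p _ => ?_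
  split_ifs with h
  · refine (Finset.sum_eq_single (⟨nb x.1 p, h⟩ : LatticeBall d n) ?_ ?_).trans ?_
    rotate_left 2
    · simp
    · intro y _ hy
      rw [if_neg fun e => hy (Subtype.ext e), zero_mul]
    · exact fun h => absurd (@Finset.mem_univ (LatticeBall d n) _ _) h
  · rw [mul_zero]
    refine Finset.sum_eq_zero fun y _ => ?_
    rw [if_neg, zero_mul]
    intro e
    exact h (e ▸ y.2)

theorem lat_up (d n : ℕ) (x : LatticeBall d n) (F : (Fin d → ℤ) → ℝ) (h : ∀ p, 0 ≤ F (nb x.1 p)) :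
    ∑ y, (latticeKernel d n x y).toReal * F y.1 ≤ (2 * d : ℝ)⁻¹ * ∑ p, F (nb x.1 p) := by
  rw [lat_sum]
  refine mul_le_mul_of_nonneg_left (Finset.sum_le_sum fun p _ => ?_) (by positivity)
  split_ifs
  · exact le_rfl
  · exact h p

theorem lat_down (d n : ℕ) (x : LatticeBall d n) (F : (Fin d → ℤ) → ℝ)
    (h : ∀ w : Fin d → ℤ, (n : ℤ) < ∑ i, (w i) ^ 2 → F w ≤ 0) :
    (2 * d : ℝ)⁻¹ * ∑ p, F (nb x.1 p) ≤ ∑ y, (latticeKernel d n x y).toReal * F y.1 := by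
  rw [lat_sum]
  refine mul_le_mul_of_nonneg_left (Finset.sum_le_sum fun p _ => ?_) (by positivity)
  split_ifs with h1
  · exact le_rfl
  · exact h _ (not_le.1 h1)

instance (d n : ℕ) : Nonempty (LatticeBall d n) := ⟨⟨fun _ => 0, by simp⟩⟩

end Lattice
end ARW

namespace ARW
set_option linter.unusedSectionVars false
set_option linter.unusedSimpArgs false
set_option linter.unusedVariables false

section Est

theorem weier {ι : Type} [DecidableEq ι] (s : Finset ι) (a : ι → ℝ) (h0 : ∀ i, 0 ≤ a i) (h1 : ∀ i, a i ≤ 1) :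
    1 - ∑ i ∈ s, a i ≤ ∏ i ∈ s, (1 - a i) ∧ 0 ≤ ∏ i ∈ s, (1 - a i) ∧ ∏ i ∈ s, (1 - a i) ≤ 1 := by
  induction s using Finset.induction_on with
  | empty => simp
  | insert i s hi ih =>
    rw [Finset.sum_insert hi, Finset.prod_insert hi]
    obtain ⟨i1, i2, i3⟩ := ih
    have b0 := h0 i
    have b1 := h1 i
    refine ⟨by nlinarith, mul_nonneg (by linarith) i2, by nlinarith⟩

theorem log_sub (d : ℕ) (hd : 2 ≤ d) (a : Fin d → ℝ) (s : ℝ) (hs : s = ∑ i, a i ^ 2 + 1) :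
    2 * d * Real.log s ≤ ∑ i, (Real.log (s + 1 + 2 * a i) + Real.log (s + 1 - 2 * a i)) := by
  have hle : ∀ i, a i ^ 2 ≤ s - 1 := fun i => by
    have := Finset.single_le_sum (f := fun i => a i ^ 2) (fun i _ => sq_nonneg (a i)) (Finset.mem_univ i)
    linarith
  have hs1 : 1 ≤ s := by
    have : 0 ≤ ∑ i, a i ^ 2 := Finset.sum_nonneg fun i _ => sq_nonneg _
    linarith
  have hp : ∀ i, 0 < s + 1 + 2 * a i := fun i => by nlinarith [hle i, sq_nonneg (a i + 1)]
  have hm : ∀ i, 0 < s + 1 - 2 * a i := fun i => by nlinarith [hle i, sq_nonneg (a i - 1)]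
  have e1 : ∑ i, (Real.log (s + 1 + 2 * a i) + Real.log (s + 1 - 2 * a i)) =
      Real.log (∏ i, ((s + 1) ^ 2 * (1 - 4 * a i ^ 2 / (s + 1) ^ 2))) := by
    have : ∀ i, (s + 1) ^ 2 * (1 - 4 * a i ^ 2 / (s + 1) ^ 2) =
        (s + 1 + 2 * a i) * (s + 1 - 2 * a i) := fun i => by field_simp; ring
    simp_rw [this]
    rw [Real.log_prod fun i _ => (mul_pos (hp i) (hm i)).ne']
    exact Finset.sum_congr rfl fun i _ => (Real.log_mul (hp i).ne' (hm i).ne').symm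
  have hw := weier Finset.univ (fun i => 4 * a i ^ 2 / (s + 1) ^ 2) (fun i => by positivity) (fun i => by
    rw [div_le_one (by positivity)]
    nlinarith [hle i, sq_nonneg (s - 1)])
  have hsum : ∑ i, 4 * a i ^ 2 / (s + 1) ^ 2 = 4 * (s - 1) / (s + 1) ^ 2 := by
    rw [← Finset.sum_div, ← Finset.mul_sum]
    congr 2
    linarith
  rw [hsum] at hw
  obtain ⟨k, rfl⟩ : ∃ k, d = k + 2 := ⟨d - 2, by omega⟩
  rw [e1, Finset.prod_mul_distrib, Finset.prod_const, Finset.card_univ, Fintype.card_fin]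
  have e2 : 2 * ((k + 2 : ℕ) : ℝ) * Real.log s = Real.log ((s ^ 2) ^ (k + 2)) := by
    rw [Real.log_pow, Real.log_pow]; push_cast; ring
  rw [e2]
  apply Real.log_le_log (by positivity)
  have e3 : s ^ 4 ≤ ((s + 1) ^ 2) ^ 2 * (1 - 4 * (s - 1) / (s + 1) ^ 2) := by
    have : ((s + 1) ^ 2) ^ 2 * (1 - 4 * (s - 1) / (s + 1) ^ 2) = (s + 1) ^ 2 * ((s + 1) ^ 2 - 4 * (s - 1)) := by
      field_simp
    rw [this]; nlinarith
  have e4 : (s ^ 2) ^ k ≤ ((s + 1) ^ 2) ^ k := by gcongr; linarith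
  calc (s ^ 2) ^ (k + 2) = (s ^ 2) ^ k * s ^ 4 := by ring
    _ ≤ ((s + 1) ^ 2) ^ k * (((s + 1) ^ 2) ^ 2 * (1 - 4 * (s - 1) / (s + 1) ^ 2)) := by gcongr
    _ = ((s + 1) ^ 2) ^ (k + 2) * (1 - 4 * (s - 1) / (s + 1) ^ 2) := by ring
    _ ≤ _ := by gcongr; exact hw.1

theorem nb_sq {d : ℕ} (z x : Fin d → ℤ) (p : Fin d × Bool) :
    ∑ j, (nb z p j - x j) ^ 2 = ∑ j, (z j - x j) ^ 2 + 2 * sgn p.2 * (z p.1 - x p.1) + 1 := by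
  rw [sum_nb z p (fun j w => (w - x j) ^ 2)]
  rcases p with ⟨i, b⟩
  cases b <;> simp [sgn] <;> ring

theorem nb_sq0 {d : ℕ} (z : Fin d → ℤ) (p : Fin d × Bool) :
    ∑ j, (nb z p j) ^ 2 = ∑ j, (z j) ^ 2 + 2 * sgn p.2 * z p.1 + 1 := by
  have := nb_sq z 0 p
  simpa using this

theorem sum_p {d : ℕ} (φ : Fin d × Bool → ℝ) : ∑ p, φ p = ∑ i, (φ (i, true) + φ (i, false)) := by
  rw [Fintype.sum_prod_type]
  simp

noncomputable def Uf (d : ℕ) (c : ℝ) (w : Fin d → ℤ) : ℝ := c - ((∑ i, (w i) ^ 2 : ℤ) : ℝ)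

theorem Uf_avg (d : ℕ) (hd : 1 ≤ d) (c : ℝ) (z : Fin d → ℤ) :
    (2 * d : ℝ)⁻¹ * ∑ p, Uf d c (nb z p) = Uf d c z - 1 := by
  rw [sum_p]
  have : ∀ i, Uf d c (nb z (i, true)) + Uf d c (nb z (i, false)) = 2 * (Uf d c z - 1) := by
    intro i
    simp only [Uf, nb_sq0, sgn]
    push_cast
    simp
    ring
  simp_rw [this]
  rw [Finset.sum_const, Finset.card_univ, Fintype.card_fin, nsmul_eq_mul]
  have : (d : ℝ) ≠ 0 := by positivity
  field_simp

noncomputable def Lf (d : ℕ) (A : ℝ) (x w : Fin d → ℤ) : ℝ :=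
  (A - Real.log (((∑ i, (w i - x i) ^ 2 : ℤ) : ℝ) + 1)) / Real.log 2

theorem Lf_avg (d : ℕ) (hd : 2 ≤ d) (A : ℝ) (x z : Fin d → ℤ) :
    (2 * d : ℝ)⁻¹ * ∑ p, Lf d A x (nb z p) ≤ Lf d A x z - (if z = x then 1 else 0) := by
  have hl := Real.log_pos (by norm_num : (1 : ℝ) < 2)
  have hd0 : (0 : ℝ) < d := by positivity
  split_ifs with h
  · subst h
    have : ∀ p, Lf d A z (nb z p) = (A - Real.log 2) / Real.log 2 := by
      intro p
      simp only [Lf, nb_sq]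
      simp
      norm_num
    simp_rw [this]
    rw [Finset.sum_const, Finset.card_univ, nsmul_eq_mul]
    simp [Lf]
    field_simp
    simp
  · rw [sub_zero, sum_p, inv_mul_le_iff₀ (by positivity)]
    have key := log_sub d hd (fun i => ((z i - x i : ℤ) : ℝ)) (((∑ i, (z i - x i) ^ 2 : ℤ) : ℝ) + 1)
      (by push_cast; rfl)
    set s := (((∑ i, (z i - x i) ^ 2 : ℤ) : ℝ) + 1) with hs
    have : ∀ i, Lf d A x (nb z (i, true)) + Lf d A x (nb z (i, false)) =
        2 * A / Real.log 2 - (Real.log (s + 1 + 2 * ((z i - x i : ℤ) : ℝ)) +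
          Real.log (s + 1 - 2 * ((z i - x i : ℤ) : ℝ))) / Real.log 2 := by
      intro i
      simp only [Lf, nb_sq, sgn]
      have a1 : (((∑ j, (z j - x j) ^ 2 + 2 * (if True then (1:ℤ) else -1) * (z i - x i) + 1 : ℤ) : ℝ) + 1)
        = s + 1 + 2 * ((z i - x i : ℤ) : ℝ) := by rw [hs, if_pos trivial]; push_cast; ring
      have a2 : (((∑ j, (z j - x j) ^ 2 + 2 * (if false = true then (1:ℤ) else -1) * (z i - x i) + 1 : ℤ) : ℝ) + 1)
        = s + 1 - 2 * ((z i - x i : ℤ) : ℝ) := by rw [hs]; push_cast; simp; ring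
      rw [a1, a2]; ring
    simp_rw [this]
    rw [Finset.sum_sub_distrib, Finset.sum_const, Finset.card_univ, Fintype.card_fin,
      nsmul_eq_mul, Lf, ← hs]
    rw [mul_div_assoc', mul_div_assoc', ← Finset.sum_div, ← sub_div]
    gcongr
    linarith

theorem sq_close {d : ℕ} (w x : Fin d → ℤ) :
    ∑ i, (w i - x i) ^ 2 ≤ 2 * ∑ i, (w i) ^ 2 + 2 * ∑ i, (x i) ^ 2 := by
  rw [Finset.mul_sum, Finset.mul_sum, ← Finset.sum_add_distrib]
  exact Finset.sum_le_sum fun i _ => by nlinarith [sq_nonneg (w i + x i)]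

theorem nb_le {d : ℕ} (z : Fin d → ℤ) (p : Fin d × Bool) :
    ∑ i, (nb z p i) ^ 2 ≤ 2 * ∑ i, (z i) ^ 2 + 2 := by
  rw [nb_sq0]
  have := Finset.single_le_sum (f := fun i => z i ^ 2) (fun i _ => sq_nonneg (z i)) (Finset.mem_univ p.1)
  rcases p with ⟨i, b⟩
  cases b <;> simp [sgn] <;> nlinarith [sq_nonneg (z i + 1), sq_nonneg (z i - 1)]

theorem ball_d2 (d n : ℕ) (hd : 2 ≤ d) (hn : 1 ≤ n) :
    ∃ H : LatticeBall d n → LatticeBall d n → ℝ, (∀ x z, 0 ≤ H x z) ∧ (∀ x z, H x z ≤ 1) ∧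
      (∀ x z, z ≠ x → H x z ≤ ∑ y, (latticeKernel d n z y).toReal * H x y) ∧
      (∀ x, 1 ≤ ∑ z, H x z) ∧
      (∀ x, Real.sqrt n / (2 * d ^ 2) * Real.log 2 / Real.log (6 * n + 5) ≤ ∑ z, H x z) := by
  have hl := Real.log_pos (by norm_num : (1 : ℝ) < 2)
  obtain ⟨H, h0, h1, h2, h3, h4⟩ := green (latticeKernel d n) (lat_sub d n (by omega))
    (lat_nd d n (by omega)) (lat_sym d n)
  refine ⟨H, h0, h1, h2, h3, fun x => ?_⟩
  set A := Real.log (6 * n + 5) with hA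
  have hn1 : (1 : ℝ) ≤ n := by exact_mod_cast hn
  have hd2 : (2 : ℝ) ≤ d := by exact_mod_cast hd
  have hA0 : 0 < A := Real.log_pos (by linarith)
  have hU1 : ∀ z : LatticeBall d n, Uf d (n + 1) z.1 - ∑ y, (latticeKernel d n z y).toReal * Uf d (n + 1) y.1 ≤ 1 := by
    intro z
    have := lat_down d n z (Uf d (n + 1)) (fun w hw => by
      rw [Uf]
      have : ((n : ℝ) + 1) ≤ ((∑ i, (w i) ^ 2 : ℤ) : ℝ) := by exact_mod_cast hw
      linarith)
    rw [Uf_avg d (by omega)] at this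
    linarith
  have hL1 : ∀ z : LatticeBall d n, (if z = x then 1 else 0) ≤ Lf d A x.1 z.1 - ∑ y, (latticeKernel d n z y).toReal * Lf d A x.1 y.1 := by
    intro z
    have hup := lat_up d n z (Lf d A x.1) (fun p => by
      apply div_nonneg _ hl.le
      rw [sub_nonneg]
      apply Real.log_le_log
      · have : (0 : ℤ) ≤ ∑ i, (nb z.1 p i - x.1 i) ^ 2 := Finset.sum_nonneg fun i _ => sq_nonneg _
        have : (0 : ℝ) ≤ ((∑ i, (nb z.1 p i - x.1 i) ^ 2 : ℤ) : ℝ) := by exact_mod_cast this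
        linarith
      · have a1 := sq_close (nb z.1 p) x.1
        have a2 := nb_le z.1 p
        have a3 := x.2
        have a4 := z.2
        have : ∑ i, (nb z.1 p i - x.1 i) ^ 2 + 1 ≤ 6 * (n : ℤ) + 5 := by linarith
        exact_mod_cast this)
    have hav := Lf_avg d hd A x.1 z.1
    have e : (if z = x then (1 : ℝ) else 0) = if z.1 = x.1 then 1 else 0 := by
      by_cases h : z = x
      · simp [h]
      · rw [if_neg h, if_neg fun e => h (Subtype.ext e)]
    rw [e]
    linarith
  obtain ⟨g1, g2⟩ := h4 x (fun z => Uf d (n + 1) z.1) (fun z => Lf d A x.1 z.1) hU1 hL1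
  have hfx : Lf d A x.1 x.1 = A / Real.log 2 := by simp [Lf]
  simp only [hfx] at g1 g2
  rw [div_le_iff₀ hA0]
  set Sx := ∑ z, H x z
  have hE : Real.sqrt n / (2 * d ^ 2) ≤ A / Real.log 2 * Sx → Real.sqrt n / (2 * d ^ 2) * Real.log 2 ≤ Sx * A := by
    intro h
    have : A / Real.log 2 * Sx = (Sx * A) / Real.log 2 := by ring
    rwa [this, le_div_iff₀ hl] at h
  apply hE
  have hx := x.2
  have hsq : Real.sqrt n ≤ n := by
    rw [Real.sqrt_le_left (by positivity)]; nlinarith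
  have hsq0 := Real.sqrt_nonneg (n : ℝ)
  have hxr : ((∑ i, (x.1 i) ^ 2 : ℤ) : ℝ) ≤ n := by exact_mod_cast hx
  by_cases hc : 2 * ((∑ i, (x.1 i) ^ 2 : ℤ) : ℝ) ≤ n
  · refine le_trans ?_ g1
    rw [div_le_iff₀ (by positivity), Uf]
    nlinarith [mul_self_nonneg (d - 2 : ℝ)]
  · push Not at hc
    refine le_trans ?_ g2
    obtain ⟨i, -, hi⟩ := Finset.exists_max_image Finset.univ (fun i => (x.1 i) ^ 2)
      ⟨(⟨0, by omega⟩ : Fin d), Finset.mem_univ _⟩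
    have hi2 : ∑ j, (x.1 j) ^ 2 ≤ d * (x.1 i) ^ 2 := by
      calc ∑ j, (x.1 j) ^ 2 ≤ ∑ j : Fin d, (x.1 i) ^ 2 := Finset.sum_le_sum fun j hj => hi j hj
        _ = _ := by simp
    have hi3 : ((∑ i, (x.1 i) ^ 2 : ℤ) : ℝ) ≤ d * (x.1 i : ℝ) ^ 2 := by exact_mod_cast hi2
    set b : Bool := decide (x.1 i < 0) with hb
    have hsg : sgn b * x.1 i = - |x.1 i| := by
      by_cases h : x.1 i < 0
      · simp [hb, h, sgn, abs_of_neg h]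
      · push Not at h
        simp [hb, not_lt.2 h, sgn, abs_of_nonneg h]
    have hnz : 1 ≤ |x.1 i| := by
      apply Int.one_le_abs
      intro h
      rw [h] at hi3
      have : (n : ℝ) < 0 := by
        have : ((0 : ℤ) : ℝ) ^ 2 = 0 := by norm_num
        rw [this] at hi3
        linarith
      linarith
    have hnbe := nb_sq0 x.1 (i, b)
    simp only [mul_assoc, hsg] at hnbe
    have hnbm : ∑ j, (nb x.1 (i, b) j) ^ 2 ≤ (n : ℤ) := by rw [hnbe]; linarith
    rw [lat_sum d n x (Uf d (n + 1))]
    have hterm : 2 * |(x.1 i : ℝ)| ≤ ∑ p, if ∑ i, (nb x.1 p i) ^ 2 ≤ (n : ℤ) then Uf d (n + 1) (nb x.1 p) else 0 := by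
      refine le_trans ?_ (Finset.single_le_sum (f := fun p => if ∑ i, (nb x.1 p i) ^ 2 ≤ (n : ℤ) then Uf d (n + 1) (nb x.1 p) else 0) (fun p _ => ?_) (Finset.mem_univ (i, b)))
      · rw [if_pos hnbm, Uf, hnbe]
        push_cast
        push_cast at hxr
        linarith
      · split_ifs with h
        · rw [Uf]
          have : ((∑ j, (nb x.1 p j) ^ 2 : ℤ) : ℝ) ≤ n := by exact_mod_cast h
          linarith
        · exact le_rfl
    refine le_trans ?_ (mul_le_mul_of_nonneg_left hterm (by positivity))
    have hfin : Real.sqrt n ≤ 2 * d * |(x.1 i : ℝ)| := by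
      rw [Real.sqrt_le_left (by positivity), mul_pow, sq_abs]
      nlinarith
    rw [div_le_iff₀ (by positivity)]
    have e : (2 * (d : ℝ))⁻¹ * (2 * |(x.1 i : ℝ)|) * (2 * (d : ℝ) ^ 2) = 2 * d * |(x.1 i : ℝ)| := by
      field_simp
    rw [e]
    exact hfin

theorem ball_d1 (n : ℕ) :
    ∃ H : LatticeBall 1 n → LatticeBall 1 n → ℝ, (∀ x z, 0 ≤ H x z) ∧ (∀ x z, H x z ≤ 1) ∧
      (∀ x z, z ≠ x → H x z ≤ ∑ y, (latticeKernel 1 n z y).toReal * H x y) ∧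
      (∀ x, (Nat.sqrt n + 1 : ℝ) ≤ ∑ z, H x z) := by
  obtain ⟨H, h0, h1, h2, h3, h4⟩ := green (latticeKernel 1 n) (lat_sub 1 n le_rfl)
    (lat_nd 1 n le_rfl) (lat_sym 1 n)
  refine ⟨H, h0, h1, h2, fun x => ?_⟩
  set m := Nat.sqrt n with hm
  have habs : ∀ z : LatticeBall 1 n, -(m : ℝ) ≤ z.1 0 ∧ (z.1 0 : ℝ) ≤ m := by
    intro z
    have hz := z.2
    simp at hz
    have h5 : (z.1 0).natAbs ≤ m := by
      rw [hm, Nat.le_sqrt']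
      zify; simpa using hz
    constructor
    · have : -(m : ℤ) ≤ z.1 0 := by omega
      exact_mod_cast this
    · have : z.1 0 ≤ (m : ℤ) := by omega
      exact_mod_cast this
  set M : ℝ := (m : ℝ) + 1 with hM
  have hM0 : 0 < M := by positivity
  set L : (Fin 1 → ℤ) → ℝ := fun w => min ((w 0 + M) * (M - x.1 0)) ((M - w 0) * (x.1 0 + M)) / M with hL
  have hxa := habs x
  have hU1 : ∀ z : LatticeBall 1 n, Uf 1 (M ^ 2) z.1 - ∑ y, (latticeKernel 1 n z y).toReal * Uf 1 (M ^ 2) y.1 ≤ 1 := by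
    intro z
    have := lat_down 1 n z (Uf 1 (M ^ 2)) (fun w hw => by
      rw [Uf]
      have h5 : (m + 1) ^ 2 ≤ (w 0).natAbs ^ 2 := by
        have h6 : m < (w 0).natAbs := by
          rw [hm, Nat.sqrt_lt']
          zify
          simpa using hw
        exact Nat.pow_le_pow_left h6 2
      have h7 : ((m : ℤ) + 1) ^ 2 ≤ (w 0) ^ 2 := by
        have := (Nat.cast_le (α := ℤ)).2 h5
        push_cast at this
        simpa using this
      have h8 : M ^ 2 ≤ (w 0 : ℝ) ^ 2 := by rw [hM]; exact_mod_cast h7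
      simp
      linarith)
    rw [Uf_avg 1 le_rfl] at this
    linarith
  have hL1 : ∀ z : LatticeBall 1 n, (if z = x then 1 else 0) ≤ L z.1 - ∑ y, (latticeKernel 1 n z y).toReal * L y.1 := by
    intro z
    have hza := habs z
    have hup := lat_up 1 n z L (fun p => by
      apply div_nonneg _ hM0.le
      have hp1 : p.1 = 0 := Subsingleton.elim _ _
      have : ((nb z.1 p 0 : ℤ) : ℝ) = z.1 0 + sgn p.2 := by
        rw [← hp1]; simp [nb]
      rw [this]
      have h9 : -1 ≤ ((sgn p.2 : ℤ) : ℝ) ∧ ((sgn p.2 : ℤ) : ℝ) ≤ 1 := by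
        cases p.2 <;> simp [sgn]
      apply le_min
      · apply mul_nonneg <;> linarith
      · apply mul_nonneg <;> linarith)
    rw [sum_p] at hup
    simp only [Finset.univ_unique, Fin.default_eq_zero, Finset.sum_singleton] at hup
    have e1 : ((nb z.1 (0, true) 0 : ℤ) : ℝ) = z.1 0 + 1 := by simp [nb, sgn]
    have e2 : ((nb z.1 (0, false) 0 : ℤ) : ℝ) = z.1 0 - 1 := by simp [nb, sgn]; ring
    have e3 : ∑ y, (latticeKernel 1 n z y).toReal * L y.1 ≤ (L (nb z.1 (0, true)) + L (nb z.1 (0, false))) / 2 := by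
      refine hup.trans (le_of_eq ?_)
      push_cast; ring
    suffices hS : (L (nb z.1 (0, true)) + L (nb z.1 (0, false))) / 2 ≤ L z.1 - (if z = x then 1 else 0) by
      linarith
    simp only [hL, e1, e2]
    rw [← add_div, div_div, mul_comm M 2, ← div_div]
    split_ifs with h
    · subst h
      have c1 := min_le_right (((z.1 0 : ℝ) + 1 + M) * (M - z.1 0)) ((M - (z.1 0 + 1)) * (z.1 0 + M))
      have c2 := min_le_left (((z.1 0 : ℝ) - 1 + M) * (M - z.1 0)) ((M - (z.1 0 - 1)) * (z.1 0 + M))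
      have e4 : ∀ a : ℝ, (a / M - 1) * M = a - M := fun a => by field_simp
      rw [mul_comm (M - (z.1 0 : ℝ)) _, min_self, div_le_iff₀ hM0, e4]
      linarith
    · rw [sub_zero]
      gcongr
      apply le_min
      · have c1 := min_le_left (((z.1 0 : ℝ) + 1 + M) * (M - x.1 0)) ((M - (z.1 0 + 1)) * (x.1 0 + M))
        have c2 := min_le_left (((z.1 0 : ℝ) - 1 + M) * (M - x.1 0)) ((M - (z.1 0 - 1)) * (x.1 0 + M))
        linarith
      · have c1 := min_le_right (((z.1 0 : ℝ) + 1 + M) * (M - x.1 0)) ((M - (z.1 0 + 1)) * (x.1 0 + M))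
        have c2 := min_le_right (((z.1 0 : ℝ) - 1 + M) * (M - x.1 0)) ((M - (z.1 0 - 1)) * (x.1 0 + M))
        linarith
  obtain ⟨g1, -⟩ := h4 x (fun z => Uf 1 (M ^ 2) z.1) (fun z => L z.1) hU1 hL1
  have hfx : L x.1 = ((x.1 0 + M) * (M - x.1 0)) / M := by
    simp only [hL]
    rw [mul_comm (M - (x.1 0 : ℝ)) _, min_self]
  simp only [hfx, Uf] at g1
  have e : M ^ 2 - ((∑ i, (x.1 i) ^ 2 : ℤ) : ℝ) = (x.1 0 + M) * (M - x.1 0) := by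
    simp; ring
  rw [e] at g1
  have hpos : 0 < (x.1 0 + M) * (M - x.1 0) := mul_pos (by linarith) (by linarith)
  rw [div_mul_eq_mul_div, le_div_iff₀ hM0] at g1
  exact le_of_mul_le_mul_left g1 hpos

theorem card_le (d n : ℕ) : Fintype.card (LatticeBall d n) ≤ (2 * Nat.sqrt n + 1) ^ d := by
  have hmem : ∀ x : LatticeBall d n, ∀ i,
      x.1 i ∈ Finset.Icc (-(Nat.sqrt n : ℤ)) (Nat.sqrt n : ℤ) := by
    intro x i
    have h1 : (x.1 i) ^ 2 ≤ (n : ℤ) :=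
      le_trans (Finset.single_le_sum (f := fun j => (x.1 j) ^ 2) (fun j _ => sq_nonneg (x.1 j)) (Finset.mem_univ i)) x.2
    have h5 : (x.1 i).natAbs ≤ Nat.sqrt n := by
      rw [Nat.le_sqrt']
      zify; simpa using h1
    rw [Finset.mem_Icc]; omega
  have hinj : Function.Injective (fun x : LatticeBall d n =>
      (fun i => (⟨x.1 i, hmem x i⟩ : ↥(Finset.Icc (-(Nat.sqrt n : ℤ)) (Nat.sqrt n : ℤ))))) := by
    intro a b h
    apply Subtype.ext
    funext i
    exact congrArg Subtype.val (congrFun h i)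
  refine (Fintype.card_le_of_injective _ hinj).trans (le_of_eq ?_)
  simp
  congr 1
  omega

theorem le_card (d n : ℕ) (hd : 1 ≤ d) : Nat.sqrt n + 1 ≤ Fintype.card (LatticeBall d n) := by
  have hinj : Function.Injective (fun k : Fin (Nat.sqrt n + 1) =>
      (⟨fun i => if i = ⟨0, hd⟩ then (k.1 : ℤ) else 0, by
        have h1 : k.1 ^ 2 ≤ n := by
          have := Nat.lt_succ_iff.1 k.2
          rwa [Nat.le_sqrt'] at this
        have h2 : (k.1 : ℤ) ^ 2 ≤ n := by exact_mod_cast h1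
        simpa [ite_pow] using h2⟩ : LatticeBall d n)) := by
    intro a b h
    have := congrFun (congrArg Subtype.val h) ⟨0, hd⟩
    simp at this
    exact Fin.ext this
  have := @Fintype.card_le_of_injective (Fin (Nat.sqrt n + 1)) (LatticeBall d n) _ _ _ hinj
  rwa [Fintype.card_fin] at this

end Est
end ARW

namespace ARW
set_option linter.unusedSectionVars false
set_option linter.unusedSimpArgs false
set_option linter.unusedVariables false

section Fin

theorem seq_core (N : ℕ → ℕ) (D : ℕ → ℕ → ℝ) (hN : Tendsto (fun n => (N n : ℝ)) atTop atTop)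
    (ha : ∀ᶠ n in atTop, ∀ t, 0 ≤ D n t) (hb : ∀ᶠ n in atTop, ∀ t, t < N n → D n t = 1)
    (hc : ∀ δ : ℝ, 0 < δ → ∀ η : ℝ, 0 < η → ∀ᶠ n in atTop, ∀ t : ℕ, (1 + δ) * N n ≤ t → D n t ≤ η) :
    ((fun n => ((sInf {t : ℕ | D n t ≤ 1 / 2} : ℕ) : ℝ) - N n) =o[atTop] fun n => (N n : ℝ)) ∧
    HasCutoff D (fun n => sInf {t : ℕ | D n t ≤ 1 / 2}) ∧
    ∀ ε : ℝ, 0 < ε → ∀ᶠ n in atTop, ((sInf {t : ℕ | D n t ≤ ε} : ℕ) : ℝ) ≤ 2 * N n := by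
  have hi : ∀ ε : ℝ, 0 < ε → ∀ c : ℝ, 0 < c → ∀ᶠ n in atTop, ({t : ℕ | D n t ≤ ε}).Nonempty ∧
      ((sInf {t : ℕ | D n t ≤ ε} : ℕ) : ℝ) ≤ (1 + c) * N n := by
    intro ε hε c hc0
    filter_upwards [hc (c / 2) (by positivity) ε hε, hN.eventually_ge_atTop (2 / c)] with n h1 h2
    have h3 := h1 ⌈(1 + c / 2) * (N n : ℝ)⌉₊ (Nat.le_ceil _)
    refine ⟨⟨_, h3⟩, ?_⟩
    have h4 : sInf {t : ℕ | D n t ≤ ε} ≤ ⌈(1 + c / 2) * (N n : ℝ)⌉₊ := Nat.sInf_le h3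
    have h5 : ((sInf {t : ℕ | D n t ≤ ε} : ℕ) : ℝ) ≤ (⌈(1 + c / 2) * (N n : ℝ)⌉₊ : ℝ) := by exact_mod_cast h4
    have h6 := Nat.ceil_lt_add_one (show 0 ≤ (1 + c / 2) * (N n : ℝ) by positivity)
    rw [div_le_iff₀ hc0] at h2
    nlinarith
  have lo : ∀ᶠ n in atTop, N n ≤ sInf {t : ℕ | D n t ≤ 1 / 2} := by
    filter_upwards [hi (1 / 2) (by norm_num) 1 one_pos, hb] with n h1 h2
    by_contra h3
    push Not at h3
    have h4 := h2 _ h3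
    have h5 : D n (sInf {t : ℕ | D n t ≤ 1 / 2}) ≤ 1 / 2 := Nat.sInf_mem h1.1
    rw [h4] at h5
    norm_num at h5
  refine ⟨?_, ?_, ?_⟩
  · rw [isLittleO_iff]
    intro c hc0
    filter_upwards [hi (1 / 2) (by norm_num) c hc0, lo] with n h1 h2
    have h3 : (N n : ℝ) ≤ ((sInf {t : ℕ | D n t ≤ 1 / 2} : ℕ) : ℝ) := by exact_mod_cast h2
    rw [Real.norm_of_nonneg (by linarith), Real.norm_of_nonneg (by positivity)]
    linarith [h1.2]
  · intro α hα
    refine ⟨fun h1 => ?_, fun h1 => ?_⟩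
    · refine tendsto_const_nhds.congr' ?_
      filter_upwards [hi (1 / 2) (by norm_num) ((1 - α) / 2) (by linarith), hb,
        hN.eventually_ge_atTop 1] with n h2 h3 h4
      refine (h3 _ ?_).symm
      rw [Nat.floor_lt (by positivity)]
      have h5 := mul_le_mul_of_nonneg_left h2.2 hα
      have h6 : α * (1 + (1 - α) / 2) < 1 := by nlinarith
      calc _ ≤ _ := h5
        _ = (α * (1 + (1 - α) / 2)) * N n := by ring
        _ < 1 * N n := by apply mul_lt_mul_of_pos_right h6; linarith
        _ = _ := one_mul _
    · rw [NormedAddCommGroup.tendsto_nhds_zero]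
      intro ε hε
      filter_upwards [lo, ha, hc ((α - 1) / 2) (by linarith) (ε / 2) (by positivity),
        hN.eventually_ge_atTop (2 / (α - 1))] with n h2 h3 h4 h5
      rw [Real.norm_of_nonneg (h3 _)]
      refine lt_of_le_of_lt (h4 _ ?_) (by linarith)
      have h6 := Nat.lt_floor_add_one (α * ((sInf {t : ℕ | D n t ≤ 1 / 2} : ℕ) : ℝ))
      have h7 : (N n : ℝ) ≤ ((sInf {t : ℕ | D n t ≤ 1 / 2} : ℕ) : ℝ) := by exact_mod_cast h2
      rw [div_le_iff₀ (by linarith)] at h5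
      have h8 := mul_le_mul_of_nonneg_left h7 hα
      nlinarith
  · intro ε hε
    filter_upwards [hi ε hε 1 one_pos] with n h
    linarith [h.2]

theorem gFun_ge (d n : ℕ) (hn : 3 ≤ n) : 1 ≤ gFun d n := by
  have hn3 : (3 : ℝ) ≤ n := by exact_mod_cast hn
  have hlog : 1 ≤ Real.log n := by
    rw [Real.le_log_iff_exp_le (by linarith)]
    have := Real.exp_one_lt_d9
    linarith
  unfold gFun
  split_ifs
  · exact le_rfl
  · nlinarith
  · exact one_le_pow₀ (by linarith)

theorem gFun_ge2 (d n : ℕ) (hd : 2 ≤ d) (hn : 3 ≤ n) : Real.sqrt n ^ d ≤ gFun d n := by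
  have hn3 : (3 : ℝ) ≤ n := by exact_mod_cast hn
  have hlog : 1 ≤ Real.log n := by
    rw [Real.le_log_iff_exp_le (by linarith)]
    have := Real.exp_one_lt_d9
    linarith
  have hs : Real.sqrt n ^ 2 = n := Real.sq_sqrt (by linarith)
  have hs1 : 1 ≤ Real.sqrt n := by rw [Real.one_le_sqrt]; linarith
  unfold gFun
  split_ifs with h1 h2
  · omega
  · subst h2; rw [hs]; nlinarith
  · calc Real.sqrt n ^ d ≤ Real.sqrt n ^ (2 * (d - 1)) := pow_le_pow_right₀ hs1 (by omega)
      _ = _ := by rw [pow_mul, hs]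

theorem card_bd (d n : ℕ) (hn : 1 ≤ n) : (Fintype.card (LatticeBall d n) : ℝ) ≤ 3 ^ d * Real.sqrt n ^ d := by
  have hn1 : (1 : ℝ) ≤ n := by exact_mod_cast hn
  have hs1 : 1 ≤ Real.sqrt n := by rw [Real.one_le_sqrt]; linarith
  have h2 : ((Nat.sqrt n : ℕ) : ℝ) ≤ Real.sqrt n := Real.nat_sqrt_le_real_sqrt
  rw [← mul_pow]
  calc (Fintype.card (LatticeBall d n) : ℝ) ≤ (2 * (Nat.sqrt n : ℝ) + 1) ^ d := by exact_mod_cast card_le d n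
    _ ≤ _ := by gcongr; linarith

theorem s_low (d n : ℕ) (hd : 2 ≤ d) (hn : 1 ≤ n) :
    Real.log 2 / (28 * d ^ 2) * Real.sqrt (Real.sqrt n) ≤
      Real.sqrt n / (2 * d ^ 2) * Real.log 2 / Real.log (6 * n + 5) := by
  have hn1 : (1 : ℝ) ≤ n := by exact_mod_cast hn
  have hd2 : (2 : ℝ) ≤ d := by exact_mod_cast hd
  have hl := Real.log_pos (by norm_num : (1 : ℝ) < 2)
  set y := Real.sqrt (Real.sqrt n) with hy
  have hy2 : Real.sqrt n = y ^ 2 := (Real.sq_sqrt (Real.sqrt_nonneg _)).symm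
  have hy4 : (n : ℝ) = y ^ 4 := by
    rw [← Real.sq_sqrt (show (0 : ℝ) ≤ n by linarith), hy2]; ring
  have hy1 : 1 ≤ y := by rw [hy, Real.one_le_sqrt, Real.one_le_sqrt]; linarith
  have hlog : Real.log (6 * n + 5) ≤ 14 * y := by
    calc Real.log (6 * n + 5) ≤ Real.log (11 * y ^ 4) := by
          apply Real.log_le_log (by linarith); rw [← hy4]; linarith
      _ = Real.log 11 + 4 * Real.log y := by
          rw [Real.log_mul (by norm_num) (by positivity), Real.log_pow]; norm_num
      _ ≤ _ := by
          have h1 := Real.log_le_sub_one_of_pos (show (0 : ℝ) < 11 by norm_num)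
          have h2 := Real.log_le_sub_one_of_pos (show (0 : ℝ) < y by linarith)
          linarith
  have hA0 : 0 < Real.log (6 * n + 5) := Real.log_pos (by linarith)
  rw [le_div_iff₀ hA0, hy2]
  calc Real.log 2 / (28 * d ^ 2) * y * Real.log (6 * n + 5) ≤ Real.log 2 / (28 * d ^ 2) * y * (14 * y) := by
        gcongr
    _ = _ := by field_simp; ring

/-- Summary of the estimates for one ball. -/
theorem ball_sum (d : ℕ) (hd : 1 ≤ d) : ∃ κ : ℝ, 0 < κ ∧ ∃ C : ℝ, 0 < C ∧ ∀ n, 3 ≤ n → ∀ lam : ℝ, 0 < lam →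
    ∀ π, IsStationary (arwBallMatrix d n lam) π →
    (∀ t, 0 ≤ sepDist (arwBallMatrix d n lam) π t) ∧
    (∀ t, t < Fintype.card (LatticeBall d n) → sepDist (arwBallMatrix d n lam) π t = 1) ∧
    (∀ δ : ℝ, 0 < δ → ∀ t : ℕ, (1 + δ) * Fintype.card (LatticeBall d n) ≤ t →
      sepDist (arwBallMatrix d n lam) π t ≤
        Fintype.card (LatticeBall d n) *
          Real.exp (-(δ ^ 2 / (4 + 2 * δ) * (κ * Real.sqrt (Real.sqrt n))))) ∧
    0 ≤ relTime (arwBallMatrix d n lam) ∧ relTime (arwBallMatrix d n lam) ≤ C * gFun d n := by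
  have hl := Real.log_pos (by norm_num : (1 : ℝ) < 2)
  have he : Real.exp (-1) < 1 := Real.exp_lt_one_iff.2 (by norm_num)
  have hc : 0 < (1 - Real.exp (-1))⁻¹ := inv_pos.2 (by linarith)
  by_cases h1 : d = 1
  · subst h1
    refine ⟨1, one_pos, (1 - Real.exp (-1))⁻¹ * 2, by positivity, fun n hn lam hlam π hπ => ?_⟩
    obtain ⟨H, h0, h1, h2, h3⟩ := ball_d1 n
    obtain ⟨c1, c2, c3, c4, c5⟩ := sep_core (latticeKernel 1 n) (lat_sub 1 n le_rfl) (lat_nd 1 n le_rfl) lam hlam π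
      hπ H h0 h1 h2 _ (by positivity) h3
    refine ⟨c1, c2, fun δ hδ t ht => (c3 δ hδ t ht).trans ?_, c4, c5.trans ?_⟩
    · have hn3 : (3 : ℝ) ≤ n := by exact_mod_cast hn
      have hs1 : 1 ≤ Real.sqrt n := by rw [Real.one_le_sqrt]; linarith
      have a1 : Real.sqrt (Real.sqrt n) ≤ Real.sqrt n := by
        rw [Real.sqrt_le_left (by positivity)]; nlinarith
      have a2 : Real.sqrt n ≤ (Nat.sqrt n : ℝ) + 1 := Real.real_sqrt_le_nat_sqrt_succ
      gcongr
      linarith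
    · have : gFun 1 n = 1 := by simp [gFun]
      rw [this, mul_one]
      gcongr
      rw [div_le_iff₀ (by positivity)]
      have := card_le 1 n
      have : (Fintype.card (LatticeBall 1 n) : ℝ) ≤ 2 * (Nat.sqrt n : ℝ) + 1 := by
        rw [pow_one] at this; exact_mod_cast this
      linarith
  · have hd2 : 2 ≤ d := by omega
    refine ⟨Real.log 2 / (28 * d ^ 2), by positivity, (1 - Real.exp (-1))⁻¹ * 3 ^ d, by positivity,
      fun n hn lam hlam π hπ => ?_⟩
    obtain ⟨H, h0, h1, h2, h3, h4⟩ := ball_d2 d n hd2 (by omega)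
    have hn3 : (3 : ℝ) ≤ n := by exact_mod_cast hn
    have hs1 : 1 ≤ Real.sqrt n := by rw [Real.one_le_sqrt]; linarith
    have hs2 : 1 ≤ Real.sqrt (Real.sqrt n) := by rw [Real.one_le_sqrt]; linarith
    obtain ⟨c1, c2, -, c4, c5⟩ := sep_core (latticeKernel d n) (lat_sub d n hd) (lat_nd d n hd) lam hlam π
      hπ H h0 h1 h2 1 one_pos h3
    obtain ⟨-, -, c3, -, -⟩ := sep_core (latticeKernel d n) (lat_sub d n hd) (lat_nd d n hd) lam hlam π
      hπ H h0 h1 h2 (Real.log 2 / (28 * d ^ 2) * Real.sqrt (Real.sqrt n)) (by positivity)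
      (fun x => (s_low d n hd2 (by omega)).trans (h4 x))
    refine ⟨c1, c2, c3, c4, c5.trans ?_⟩
    rw [mul_assoc, div_one]
    gcongr
    exact (card_bd d n (by omega)).trans (mul_le_mul_of_nonneg_left (gFun_ge2 d n hd2 hn) (by positivity))

theorem decay (d : ℕ) (c : ℝ) (hc : 0 < c) :
    Tendsto (fun n : ℕ => 3 ^ d * Real.sqrt n ^ d * Real.exp (-(c * Real.sqrt (Real.sqrt n)))) atTop (nhds 0) := by
  have h1 := tendsto_rpow_mul_exp_neg_mul_atTop_nhds_zero ((2 * d : ℕ) : ℝ) c hc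
  have h2 : Tendsto (fun n : ℕ => Real.sqrt (Real.sqrt (n : ℝ))) atTop atTop :=
    Real.tendsto_sqrt_atTop.comp (Real.tendsto_sqrt_atTop.comp tendsto_natCast_atTop_atTop)
  have h3 := (h1.comp h2).const_mul ((3 : ℝ) ^ d)
  rw [mul_zero] at h3
  refine h3.congr fun n => ?_
  simp only [Function.comp]
  rw [Real.rpow_natCast, pow_mul, Real.sq_sqrt (Real.sqrt_nonneg _)]
  ring_nf

theorem main_thm
    (d : ℕ) (hd : 1 ≤ d)
    (lam : ℕ → ℝ) (hlam : ∀ n, 0 < lam n)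
    (π : ∀ n, (LatticeBall d n → Bool) → ℝ)
    (hπ : ∀ n, IsStationary (arwBallMatrix d n (lam n)) (π n)) :
    ((fun n => relTime (arwBallMatrix d n (lam n))) =O[atTop] fun n => gFun d n)
    ∧ ((fun n => (sepMix (arwBallMatrix d n (lam n)) (π n) (1 / 2) : ℝ)
          - (Fintype.card (LatticeBall d n) : ℝ))
        =o[atTop] fun n => (Fintype.card (LatticeBall d n) : ℝ))
    ∧ HasCutoff (fun n t => sepDist (arwBallMatrix d n (lam n)) (π n) t)
        (fun n => sepMix (arwBallMatrix d n (lam n)) (π n) (1 / 2))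
    ∧ ∀ ε : ℝ, 0 < ε → ε < 1 / 2 →
        (fun n => (sepMix (arwBallMatrix d n (lam n)) (π n) ε : ℝ)
            - (sepMix (arwBallMatrix d n (lam n)) (π n) (1 - ε) : ℝ))
          =O[atTop] fun n => Real.sqrt ((n : ℝ) ^ d * gFun d n) := by
  obtain ⟨κ, hκ, C, hC, hball⟩ := ball_sum d hd
  have hb := fun n hn => hball n hn (lam n) (hlam n) (π n) (hπ n)
  have hN : Tendsto (fun n => (Fintype.card (LatticeBall d n) : ℝ)) atTop atTop := by
    refine tendsto_atTop_mono (f := fun n : ℕ => Real.sqrt (n : ℝ)) (fun n => ?_)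
      (Real.tendsto_sqrt_atTop.comp tendsto_natCast_atTop_atTop)
    have a2 : Real.sqrt n ≤ (Nat.sqrt n : ℝ) + 1 := Real.real_sqrt_le_nat_sqrt_succ
    have a3 : (Nat.sqrt n : ℝ) + 1 ≤ Fintype.card (LatticeBall d n) := by exact_mod_cast le_card d n hd
    linarith
  obtain ⟨r1, r2, r3⟩ := seq_core (fun n => Fintype.card (LatticeBall d n))
    (fun n t => sepDist (arwBallMatrix d n (lam n)) (π n) t) hN
    (by filter_upwards [eventually_ge_atTop 3] with n hn using (hb n hn).1)
    (by filter_upwards [eventually_ge_atTop 3] with n hn using (hb n hn).2.1)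
    (by
      intro δ hδ η hη
      have hc : 0 < δ ^ 2 / (4 + 2 * δ) * κ := by positivity
      filter_upwards [eventually_ge_atTop 3, (decay d _ hc).eventually_le_const hη] with n hn h1 t ht
      refine ((hb n hn).2.2.1 δ hδ t ht).trans (le_trans ?_ h1)
      rw [mul_assoc (δ ^ 2 / (4 + 2 * δ))]
      gcongr
      exact card_bd d n (by omega))
  refine ⟨?_, r1, r2, ?_⟩
  · apply IsBigO.of_bound C
    filter_upwards [eventually_ge_atTop 3] with n hn
    have hg := gFun_ge d n hn
    rw [Real.norm_of_nonneg (hb n hn).2.2.2.1, Real.norm_of_nonneg (by linarith)]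
    exact (hb n hn).2.2.2.2
  · intro ε hε hε2
    apply IsBigO.of_bound (2 * 3 ^ d)
    filter_upwards [eventually_ge_atTop 3, r3 ε hε, r3 (1 - ε) (by linarith)] with n hn h1 h2
    have hg := gFun_ge d n hn
    change (sepMix (arwBallMatrix d n (lam n)) (π n) ε : ℝ) ≤ _ at h1
    change (sepMix (arwBallMatrix d n (lam n)) (π n) (1 - ε) : ℝ) ≤ _ at h2
    have hcard := card_bd d n (by omega : 1 ≤ n)
    have hsq : Real.sqrt n ^ d ≤ Real.sqrt ((n : ℝ) ^ d * gFun d n) := by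
      apply Real.le_sqrt_of_sq_le
      rw [← pow_mul, mul_comm d 2, pow_mul, Real.sq_sqrt (by positivity)]
      exact le_mul_of_one_le_right (by positivity) hg
    rw [Real.norm_of_nonneg (Real.sqrt_nonneg _), Real.norm_eq_abs]
    have h0 : (2 : ℝ) * Fintype.card (LatticeBall d n) ≤ 2 * 3 ^ d * Real.sqrt ((n : ℝ) ^ d * gFun d n) := by
      calc _ ≤ 2 * (3 ^ d * Real.sqrt n ^ d) := by linarith
        _ ≤ 2 * (3 ^ d * Real.sqrt ((n : ℝ) ^ d * gFun d n)) := by gcongr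
        _ = _ := by ring
    have p1 : (0 : ℝ) ≤ (sepMix (arwBallMatrix d n (lam n)) (π n) ε : ℝ) := Nat.cast_nonneg _
    have p2 : (0 : ℝ) ≤ (sepMix (arwBallMatrix d n (lam n)) (π n) (1 - ε) : ℝ) := Nat.cast_nonneg _
    rw [abs_le]
    constructor <;> linarith

end Fin
end ARW

namespace ARW

/-- **Corollary (Cutoff on Euclidean balls).**  Fix `d ≥ 1` and let `V_n` be the
discrete Euclidean ball of radius `√n` in `ℤ^d`, with walk killed upon exiting,
uniform insertion and sleeping rates `lam_n > 0`.  Then `t_rel⁽ⁿ⁾ = O(g_d(n))`,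
`t_sep⁽ⁿ⁾ = |V_n| + o(|V_n|)`, and there is a separation cutoff with window
`O(√(n^d g_d(n)))`. -/
theorem arw_cutoff_euclidean_balls
    (d : ℕ) (hd : 1 ≤ d)
    (lam : ℕ → ℝ) (hlam : ∀ n, 0 < lam n)
    (π : ∀ n, (LatticeBall d n → Bool) → ℝ)
    (hπ : ∀ n, IsStationary (arwBallMatrix d n (lam n)) (π n)) :
    ((fun n => relTime (arwBallMatrix d n (lam n))) =O[atTop] fun n => gFun d n)
    ∧ ((fun n => (sepMix (arwBallMatrix d n (lam n)) (π n) (1 / 2) : ℝ)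
          - (Fintype.card (LatticeBall d n) : ℝ))
        =o[atTop] fun n => (Fintype.card (LatticeBall d n) : ℝ))
    ∧ HasCutoff (fun n t => sepDist (arwBallMatrix d n (lam n)) (π n) t)
        (fun n => sepMix (arwBallMatrix d n (lam n)) (π n) (1 / 2))
    ∧ ∀ ε : ℝ, 0 < ε → ε < 1 / 2 →
        (fun n => (sepMix (arwBallMatrix d n (lam n)) (π n) ε : ℝ)
            - (sepMix (arwBallMatrix d n (lam n)) (π n) (1 - ε) : ℝ))
          =O[atTop] fun n => Real.sqrt ((n : ℝ) ^ d * gFun d n) := by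
  exact main_thm d hd lam hlam π hπ

end ARW
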